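/- Let φ : A → B be a DG smooth homomorphism of strongly commutative DG R-algebras with diagonal ideal J and filtration {J^[ℓ]}. Let N be a semifree DG B-module with Ext^i_B(N,N) = 0 for all i ≥ 1. Then for all i ≥ 0 and all ℓ ≥ 1, both Ext^i_B(N, N ⊗_B J^[ℓ]/J^[ℓ+1]) = 0 and Ext^i_B(N, N ⊗_B J/J^[ℓ]) = 0. -/

import Mathlib

/-!
Common framework: strongly commutative non-negatively graded DG algebras over a
commutative ring `R`, right DG modules, semifree DG modules, Ext via the Hom complex,
homotopies, enveloping DG algebras, diagonal ideals, DG (quasi-)smoothness,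
polynomial and free (divided power) extensions, and naive lifting.
-/

noncomputable section

/-- The Koszul sign `(-1)^i` for an integer `i`. -/
def ksign (i : ℤ) : ℤ := (((-1 : ℤˣ) ^ i : ℤˣ) : ℤ)

/-- A strongly commutative, non-negatively graded differential graded algebra over a
commutative ring `R`: a graded `R`-algebra `A = ⊕_{n ≥ 0} A_n` with
`a * b = (-1)^{|a||b|} b * a`, `a^2 = 0` for `|a|` odd, and an `R`-linear degree `-1`
differential `d` with `d ∘ d = 0` satisfying the Leibniz rule. -/
structure DGAlgebra (R : Type) [CommRing R] where
  carrier : Type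
  [ring : Ring carrier]
  [alg : Algebra R carrier]
  grading : ℤ → Submodule R carrier
  indep : ∀ i : ℤ, Disjoint (grading i) (⨆ j ≠ i, grading j)
  spanning : (⨆ i, grading i) = ⊤
  nonneg : ∀ i : ℤ, i < 0 → grading i = ⊥
  one_mem : (1 : carrier) ∈ grading 0
  mul_mem : ∀ {i j : ℤ} {a b : carrier}, a ∈ grading i → b ∈ grading j →
    a * b ∈ grading (i + j)
  gcomm : ∀ {i j : ℤ} (a b : carrier), a ∈ grading i → b ∈ grading j →
    a * b = ksign (i * j) • (b * a)
  odd_sq : ∀ {i : ℤ} (a : carrier), Odd i → a ∈ grading i → a * a = 0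
  d : carrier → carrier
  d_add : ∀ a b, d (a + b) = d a + d b
  d_rsmul : ∀ (r : R) a, d (r • a) = r • d a
  d_mem : ∀ {i : ℤ} {a : carrier}, a ∈ grading i → d a ∈ grading (i - 1)
  d_sq : ∀ a, d (d a) = 0
  leibniz : ∀ {i : ℤ} (a b : carrier), a ∈ grading i →
    d (a * b) = d a * b + ksign i • (a * d b)

attribute [instance] DGAlgebra.ring DGAlgebra.alg

variable {R : Type} [CommRing R]

/-- A right DG module over a DG `R`-algebra `A`. -/
structure DGModule (R : Type) [CommRing R] (A : DGAlgebra R) where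
  carrier : Type
  [acg : AddCommGroup carrier]
  [modR : Module R carrier]
  grading : ℤ → Submodule R carrier
  indep : ∀ i : ℤ, Disjoint (grading i) (⨆ j ≠ i, grading j)
  spanning : (⨆ i, grading i) = ⊤
  smul : carrier → A.carrier → carrier
  smul_add : ∀ (m : carrier) (a b : A.carrier), smul m (a + b) = smul m a + smul m b
  add_smul : ∀ (m n : carrier) (a : A.carrier), smul (m + n) a = smul m a + smul n a
  smul_rsmul : ∀ (r : R) (m : carrier) (a : A.carrier), smul m (r • a) = r • smul m a
  rsmul_smul : ∀ (r : R) (m : carrier) (a : A.carrier), smul (r • m) a = r • smul m a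
  smul_one : ∀ m : carrier, smul m 1 = m
  smul_mul : ∀ (m : carrier) (a b : A.carrier), smul (smul m a) b = smul m (a * b)
  smul_mem : ∀ {i j : ℤ} {m : carrier} {a : A.carrier},
    m ∈ grading i → a ∈ A.grading j → smul m a ∈ grading (i + j)
  d : carrier → carrier
  d_add : ∀ x y, d (x + y) = d x + d y
  d_rsmul : ∀ (r : R) x, d (r • x) = r • d x
  d_mem : ∀ {i : ℤ} {m : carrier}, m ∈ grading i → d m ∈ grading (i - 1)
  d_sq : ∀ m, d (d m) = 0
  leibniz : ∀ {i : ℤ} (m : carrier) (a : A.carrier), m ∈ grading i →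
    d (smul m a) = smul (d m) a + ksign i • smul m (A.d a)

attribute [instance] DGModule.acg DGModule.modR

/-- A graded `A`-linear map of degree `k` between DG `A`-modules (not necessarily
compatible with the differentials). -/
structure GradedHom {A : DGAlgebra R} (M N : DGModule R A) (k : ℤ) where
  toFun : M.carrier → N.carrier
  map_add : ∀ x y, toFun (x + y) = toFun x + toFun y
  map_rsmul : ∀ (r : R) x, toFun (r • x) = r • toFun x
  map_smul : ∀ (x : M.carrier) (a : A.carrier), toFun (M.smul x a) = N.smul (toFun x) a
  map_mem : ∀ {i : ℤ} {x : M.carrier}, x ∈ M.grading i → toFun x ∈ N.grading (i + k)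

/-- A homomorphism of DG `A`-modules: a degree `0` graded `A`-linear chain map. -/
structure DGHom {A : DGAlgebra R} (M N : DGModule R A) where
  toFun : M.carrier → N.carrier
  map_add : ∀ x y, toFun (x + y) = toFun x + toFun y
  map_rsmul : ∀ (r : R) x, toFun (r • x) = r • toFun x
  map_smul : ∀ (x : M.carrier) (a : A.carrier), toFun (M.smul x a) = N.smul (toFun x) a
  map_mem : ∀ {i : ℤ} {x : M.carrier}, x ∈ M.grading i → toFun x ∈ N.grading i
  comm_d : ∀ x, toFun (M.d x) = N.d (toFun x)

/-- A degree `-k` element `f` of the Hom complex `Hom_A(N, M)` is a cocycle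
(representing a class in `Ext^k_A(N,M) = H_{-k}(Hom_A(N,M))`). -/
def IsExtCocycle {A : DGAlgebra R} {N M : DGModule R A} (k : ℤ)
    (f : GradedHom N M (-k)) : Prop :=
  ∀ x, M.d (f.toFun x) = ksign k • f.toFun (N.d x)

/-- A degree `-k` cocycle of the Hom complex is a coboundary. -/
def IsExtCoboundary {A : DGAlgebra R} {N M : DGModule R A} (k : ℤ)
    (f : GradedHom N M (-k)) : Prop :=
  ∃ h : GradedHom N M (-k + 1), ∀ x,
    f.toFun x = M.d (h.toFun x) + ksign k • h.toFun (N.d x)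

/-- `Ext^k_A(N, M) = H_{-k}(Hom_A(N, M)) = 0`. -/
def ExtVanish {A : DGAlgebra R} (k : ℤ) (N M : DGModule R A) : Prop :=
  ∀ f : GradedHom N M (-k), IsExtCocycle k f → IsExtCoboundary k f

/-- A DG module homomorphism `j : M' → M` induces an isomorphism
`Ext^k_A(N, M') ≅ Ext^k_A(N, M)`; stated at the level of cocycles and coboundaries
of the Hom complexes (injectivity and surjectivity of the induced map on `H_{-k}`). -/
def InducesExtIso {A : DGAlgebra R} (k : ℤ) (N : DGModule R A) {M' M : DGModule R A}
    (j : DGHom M' M) : Prop :=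
  (∀ f : GradedHom N M' (-k), IsExtCocycle k f →
    (∃ h : GradedHom N M (-k + 1), ∀ x,
      j.toFun (f.toFun x) = M.d (h.toFun x) + ksign k • h.toFun (N.d x)) →
    IsExtCoboundary k f) ∧
  (∀ g : GradedHom N M (-k), IsExtCocycle k g →
    ∃ f : GradedHom N M' (-k), IsExtCocycle k f ∧
      ∃ h : GradedHom N M (-k + 1), ∀ x,
        j.toFun (f.toFun x) - g.toFun x = M.d (h.toFun x) + ksign k • h.toFun (N.d x))

/-- Two maps of DG `A`-modules are homotopic: `f - g = ∂ ∘ h + h ∘ ∂` for a graded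
`A`-linear map `h` of degree `1`. -/
def DGHomotopic {A : DGAlgebra R} {M N : DGModule R A}
    (f g : M.carrier → N.carrier) : Prop :=
  ∃ h : GradedHom M N 1, ∀ x, f x - g x = N.d (h.toFun x) + h.toFun (M.d x)

/-- A DG module homomorphism `j : M' → M` induces a bijection
`Hom_{K(A)}(N, M') ≅ Hom_{K(A)}(N, M)` on homotopy classes of DG homomorphisms. -/
def InducesHtpyBij {A : DGAlgebra R} (N : DGModule R A) {M' M : DGModule R A}
    (j : DGHom M' M) : Prop :=
  (∀ f g : DGHom N M',
    DGHomotopic (fun x => j.toFun (f.toFun x)) (fun x => j.toFun (g.toFun x)) →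
    DGHomotopic f.toFun g.toFun) ∧
  (∀ g : DGHom N M, ∃ f : DGHom N M',
    DGHomotopic (fun x => j.toFun (f.toFun x)) g.toFun)

/-- A semifree basis of a DG `A`-module `N` on a family `e : κ → N`: a well-ordering
of `κ`, degrees making each `e k` homogeneous, such that `e` is a basis of the
underlying graded `A`-module and `∂(e k) ∈ Σ_{j < k} (e j)·A`. -/
structure SemifreeBasisOn {A : DGAlgebra R} (N : DGModule R A) {κ : Type}
    (e : κ → N.carrier) where
  lt : κ → κ → Prop
  wf : WellFounded lt
  trans : ∀ a b c, lt a b → lt b c → lt a c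
  trichotomous : ∀ a b, lt a b ∨ a = b ∨ lt b a
  deg : κ → ℤ
  homog : ∀ k, e k ∈ N.grading (deg k)
  basis : Function.Bijective
    (fun c : κ →₀ A.carrier => c.sum fun k a => N.smul (e k) a)
  d_lower : ∀ k, ∃ c : κ →₀ A.carrier, (∀ j ∈ c.support, lt j k) ∧
    N.d (e k) = c.sum fun j a => N.smul (e j) a

/-- A DG `A`-module is semifree if it admits a semifree basis. -/
def IsSemifree {A : DGAlgebra R} (N : DGModule R A) : Prop :=
  ∃ (κ : Type) (e : κ → N.carrier), Nonempty (SemifreeBasisOn N e)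

/-- A DG `A`-module has a finite semifree basis. -/
def HasFiniteSemifreeBasis {A : DGAlgebra R} (N : DGModule R A) : Prop :=
  ∃ (κ : Type) (e : κ → N.carrier), Finite κ ∧ Nonempty (SemifreeBasisOn N e)

/-- A DG module is bounded below: `N_i = 0` for `i ≪ 0`. -/
def BoundedBelow {A : DGAlgebra R} (N : DGModule R A) : Prop :=
  ∃ n₀ : ℤ, ∀ i : ℤ, i < n₀ → N.grading i = ⊥

/-- A homomorphism of DG `R`-algebras. -/
structure DGAlgHom (A B : DGAlgebra R) where
  toFun : A.carrier → B.carrier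
  map_one : toFun 1 = 1
  map_mul : ∀ x y, toFun (x * y) = toFun x * toFun y
  map_add : ∀ x y, toFun (x + y) = toFun x + toFun y
  map_rsmul : ∀ (r : R) x, toFun (r • x) = r • toFun x
  map_mem : ∀ {i : ℤ} {x : A.carrier}, x ∈ A.grading i → toFun x ∈ B.grading i
  comm_d : ∀ x, toFun (A.d x) = B.d (toFun x)

/-- A DG `A`-module homomorphism from a DG `A`-module `M` to (the restriction of
scalars along `φ : A → B` of) a DG `B`-module `W`. -/
structure ResHom {A B : DGAlgebra R} (φ : DGAlgHom A B) (M : DGModule R A)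
    (W : DGModule R B) where
  toFun : M.carrier → W.carrier
  map_add : ∀ x y, toFun (x + y) = toFun x + toFun y
  map_rsmul : ∀ (r : R) x, toFun (r • x) = r • toFun x
  map_mem : ∀ {i : ℤ} {x : M.carrier}, x ∈ M.grading i → toFun x ∈ W.grading i
  map_smul : ∀ (x : M.carrier) (a : A.carrier),
    toFun (M.smul x a) = W.smul (toFun x) (φ.toFun a)
  comm_d : ∀ x, toFun (M.d x) = W.d (toFun x)

/-- `T` is (up to isomorphism) the base change `M ⊗_A B` of the DG `A`-module `M`
along `φ : A → B`: universal property of the unit map `M → T`, `m ↦ m ⊗ 1`. -/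
structure DGBaseChange {A B : DGAlgebra R} (φ : DGAlgHom A B) (M : DGModule R A)
    (T : DGModule R B) where
  unit : ResHom φ M T
  univ : ∀ (W : DGModule R B) (f : ResHom φ M W),
    ∃ g : DGHom T W, (∀ x, g.toFun (unit.toFun x) = f.toFun x) ∧
      ∀ g' : DGHom T W, (∀ x, g'.toFun (unit.toFun x) = f.toFun x) →
        ∀ t, g'.toFun t = g.toFun t

/-- A DG `B`-module `W` is liftable to `A` along `φ : A → B` if `W ≅ M ⊗_A B`
for some DG `A`-module `M`. -/
def LiftableTo {A B : DGAlgebra R} (φ : DGAlgHom A B) (W : DGModule R B) : Prop :=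
  ∃ M : DGModule R A, Nonempty (DGBaseChange φ M W)

/-- An `A`-linear (via `φ : A → B`) chain map between the restrictions of two
DG `B`-modules. -/
structure ResHomB {A B : DGAlgebra R} (φ : DGAlgHom A B) (N W : DGModule R B) where
  toFun : N.carrier → W.carrier
  map_add : ∀ x y, toFun (x + y) = toFun x + toFun y
  map_rsmul : ∀ (r : R) x, toFun (r • x) = r • toFun x
  map_mem : ∀ {i : ℤ} {x : N.carrier}, x ∈ N.grading i → toFun x ∈ W.grading i
  map_smul : ∀ (x : N.carrier) (a : A.carrier),
    toFun (N.smul x (φ.toFun a)) = W.smul (toFun x) (φ.toFun a)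
  comm_d : ∀ x, toFun (N.d x) = W.d (toFun x)

/-- `T` is (up to isomorphism) the induced DG `B`-module `N|_A ⊗_A B` of a
DG `B`-module `N` along `φ : A → B`, with unit map `n ↦ n ⊗ 1`. -/
structure InducedModuleSpec {A B : DGAlgebra R} (φ : DGAlgHom A B)
    (N T : DGModule R B) where
  unit : ResHomB φ N T
  univ : ∀ (W : DGModule R B) (f : ResHomB φ N W),
    ∃ g : DGHom T W, (∀ x, g.toFun (unit.toFun x) = f.toFun x) ∧
      ∀ g' : DGHom T W, (∀ x, g'.toFun (unit.toFun x) = f.toFun x) →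
        ∀ t, g'.toFun t = g.toFun t

/-- `N` is naively liftable to `A` along `φ : A → B`: the canonical DG `B`-module
epimorphism `π_N : N|_A ⊗_A B → N`, `n ⊗ b ↦ nb` (characterized as the unique
DG `B`-map splitting the unit) admits a right inverse DG `B`-module homomorphism. -/
def NaivelyLiftable {A B : DGAlgebra R} (φ : DGAlgHom A B) (N : DGModule R B) : Prop :=
  ∀ (T : DGModule R B) (h : InducedModuleSpec φ N T) (πN : DGHom T N),
    (∀ x, πN.toFun (h.unit.toFun x) = x) →
    ∃ ρ : DGHom N T, ∀ y, πN.toFun (ρ.toFun y) = y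

/-- `N` is a direct summand of `W` as DG modules. -/
def IsDGDirectSummandOf {A : DGAlgebra R} (N W : DGModule R A) : Prop :=
  ∃ (ρ : DGHom N W) (p : DGHom W N), ∀ x, p.toFun (ρ.toFun x) = x

/-- `N` is a direct summand of some DG `B`-module which is liftable to `A`. -/
def DirectSummandOfLiftable {A B : DGAlgebra R} (φ : DGAlgHom A B)
    (N : DGModule R B) : Prop :=
  ∃ W : DGModule R B, LiftableTo φ W ∧ IsDGDirectSummandOf N W

/-- `B` is free as an underlying graded `A`-module (via `φ : A → B`), with a basis
of homogeneous elements. -/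
def FreeOverBase {A B : DGAlgebra R} (φ : DGAlgHom A B) : Prop :=
  ∃ (κ : Type) (e : κ → B.carrier) (dg : κ → ℤ),
    (∀ k, e k ∈ B.grading (dg k)) ∧
    Function.Bijective (fun c : κ →₀ A.carrier => c.sum fun k a => e k * φ.toFun a)

/-- `E` is (up to isomorphism) the enveloping DG algebra `B^e = B^o ⊗_A B` of
`φ : A → B`: it receives the two canonical maps `l : B° → E`, `b ↦ b^o ⊗ 1` and
`r : B → E`, `b ↦ 1^o ⊗ b` agreeing on `A`, and is universal (as a pushout of
strongly commutative DG algebras) with this property. -/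
structure EnvelopingAlg {A B : DGAlgebra R} (φ : DGAlgHom A B) (E : DGAlgebra R) where
  l : DGAlgHom B E
  r : DGAlgHom B E
  compat : ∀ a, l.toFun (φ.toFun a) = r.toFun (φ.toFun a)
  univ : ∀ (C : DGAlgebra R) (f g : DGAlgHom B C),
    (∀ a, f.toFun (φ.toFun a) = g.toFun (φ.toFun a)) →
    ∃ h : DGAlgHom E C, (∀ b, h.toFun (l.toFun b) = f.toFun b) ∧
      (∀ b, h.toFun (r.toFun b) = g.toFun b) ∧
      ∀ h' : DGAlgHom E C,
        ((∀ b, h'.toFun (l.toFun b) = f.toFun b) ∧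
          (∀ b, h'.toFun (r.toFun b) = g.toFun b)) → ∀ x, h'.toFun x = h.toFun x

/-- The diagonal ideal `J = ker(π_B : B^e → B)`. -/
def diagIdeal {A B E : DGAlgebra R} {φ : DGAlgHom A B} (_ : EnvelopingAlg φ E)
    (πB : DGAlgHom E B) : Set E.carrier :=
  {x | πB.toFun x = 0}

/-- A balanced pairing `N × S → W` realizing (maps out of) `N ⊗_B (S/Z)`, where
`S ⊆ B^e` is a DG `(B,B)`-sub-bimodule of `B^e` (left `B`-action via `l`, right
`B`-action via `r`) and `Z ⊆ S` is killed. -/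
structure TensorPairing {A B E : DGAlgebra R} (φ : DGAlgHom A B)
    (he : EnvelopingAlg φ E) (S Z : Set E.carrier) (N W : DGModule R B) where
  pair : N.carrier → E.carrier → W.carrier
  add_left : ∀ n n' x, x ∈ S → pair (n + n') x = pair n x + pair n' x
  add_right : ∀ n x y, x ∈ S → y ∈ S → pair n (x + y) = pair n x + pair n y
  rsmul_left : ∀ (r : R) n x, x ∈ S → pair (r • n) x = r • pair n x
  rsmul_right : ∀ (r : R) n x, x ∈ S → pair n (r • x) = r • pair n x
  balanced : ∀ (n : N.carrier) (b : B.carrier) (x : E.carrier), x ∈ S →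
    pair (N.smul n b) x = pair n (he.l.toFun b * x)
  act_right : ∀ (n : N.carrier) (b : B.carrier) (x : E.carrier), x ∈ S →
    pair n (x * he.r.toFun b) = W.smul (pair n x) b
  grade : ∀ {i j : ℤ} (n : N.carrier) (x : E.carrier),
    n ∈ N.grading i → x ∈ S → x ∈ E.grading j → pair n x ∈ W.grading (i + j)
  chain : ∀ {i : ℤ} (n : N.carrier) (x : E.carrier), n ∈ N.grading i → x ∈ S →
    W.d (pair n x) = pair (N.d n) x + ksign i • pair n (E.d x)
  kill : ∀ n x, x ∈ Z → pair n x = 0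

/-- `P` is (up to isomorphism) the right DG `B`-module `N ⊗_B (S/Z)`:
universal property among balanced pairings. -/
structure IsTensorSubquot {A B E : DGAlgebra R} (φ : DGAlgHom A B)
    (he : EnvelopingAlg φ E) (S Z : Set E.carrier) (N P : DGModule R B) where
  pairing : TensorPairing φ he S Z N P
  univ : ∀ (W : DGModule R B) (γ : TensorPairing φ he S Z N W),
    ∃ g : DGHom P W, (∀ n x, x ∈ S → g.toFun (pairing.pair n x) = γ.pair n x) ∧
      ∀ g' : DGHom P W, (∀ n x, x ∈ S → g'.toFun (pairing.pair n x) = γ.pair n x) →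
        ∀ p, g'.toFun p = g.toFun p

/-- `Q` is (up to isomorphism) the quotient `S/Z` of DG `B^e`-submodules
`Z ⊆ S ⊆ B^e`, regarded as a right DG `B`-module via `r : B → B^e`. -/
structure SubquotModSpec {A B E : DGAlgebra R} {φ : DGAlgHom A B}
    (he : EnvelopingAlg φ E) (S Z : Set E.carrier) (Q : DGModule R B) where
  q : E.carrier → Q.carrier
  q_add : ∀ x y, x ∈ S → y ∈ S → q (x + y) = q x + q y
  q_rsmul : ∀ (r : R) x, x ∈ S → q (r • x) = r • q x
  q_mem : ∀ {i : ℤ} (x : E.carrier), x ∈ S → x ∈ E.grading i → q x ∈ Q.grading i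
  q_d : ∀ x, x ∈ S → q (E.d x) = Q.d (q x)
  q_act : ∀ (x : E.carrier) (b : B.carrier), x ∈ S →
    q (x * he.r.toFun b) = Q.smul (q x) b
  q_surj : ∀ y, ∃ x ∈ S, q x = y
  q_ker : ∀ x, x ∈ S → (q x = 0 ↔ x ∈ Z)

/-- The data exhibiting `φ : A → B` as DG quasi-smooth, relative to a realization
`E` of the enveloping DG algebra `B^e` and the multiplication map `π_B : B^e → B`:
`B` is graded-free over `A` and the diagonal ideal `J = ker π_B` carries a filtration
`J = J^[1] ⊇ J^[2] ⊇ ⋯` of DG `B^e`-submodules with `J·J^[ℓ] + J^[ℓ]·J ⊆ J^[ℓ+1]`,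
`inf J^[ℓ] ≥ ℓ`, and all subquotients `J^[ℓ]/J^[ℓ+1]` semifree over `B`. -/
structure QuasiSmoothData {A B : DGAlgebra R} (φ : DGAlgHom A B) (E : DGAlgebra R)
    (he : EnvelopingAlg φ E) (πB : DGAlgHom E B) where
  pil : ∀ b, πB.toFun (he.l.toFun b) = b
  pir : ∀ b, πB.toFun (he.r.toFun b) = b
  free : FreeOverBase φ
  filt : ℕ → Set E.carrier
  filt_one : filt 1 = {x | πB.toFun x = 0}
  filt_desc : ∀ ℓ, 1 ≤ ℓ → filt (ℓ + 1) ⊆ filt ℓ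
  filt_zero : ∀ ℓ, (0 : E.carrier) ∈ filt ℓ
  filt_add : ∀ ℓ x y, x ∈ filt ℓ → y ∈ filt ℓ → x + y ∈ filt ℓ
  filt_neg : ∀ ℓ x, x ∈ filt ℓ → -x ∈ filt ℓ
  filt_rsmul : ∀ ℓ (r : R) x, x ∈ filt ℓ → r • x ∈ filt ℓ
  filt_act : ∀ ℓ (e : E.carrier) x, x ∈ filt ℓ → x * e ∈ filt ℓ
  filt_d : ∀ ℓ x, x ∈ filt ℓ → E.d x ∈ filt ℓ
  filt_graded : ∀ ℓ x, x ∈ filt ℓ →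
    x ∈ Submodule.span R (filt ℓ ∩ ⋃ i : ℤ, (E.grading i : Set E.carrier))
  filt_mul : ∀ ℓ, 1 ≤ ℓ → ∀ a x, πB.toFun a = 0 → x ∈ filt ℓ →
    a * x ∈ filt (ℓ + 1) ∧ x * a ∈ filt (ℓ + 1)
  filt_inf : ∀ ℓ : ℕ, 1 ≤ ℓ → ∀ i : ℤ, i < (ℓ : ℤ) →
    ∀ x ∈ filt ℓ, x ∈ E.grading i → x = 0
  quot_semifree : ∀ ℓ, 1 ≤ ℓ → ∃ Q : DGModule R B,
    Nonempty (SubquotModSpec he (filt ℓ) (filt (ℓ + 1)) Q) ∧ IsSemifree Q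

/-- The data exhibiting `φ : A → B` as DG smooth: quasi-smooth, and all
subquotients `J^[ℓ]/J^[ℓ+1]` have finite semifree bases. -/
structure SmoothData {A B : DGAlgebra R} (φ : DGAlgHom A B) (E : DGAlgebra R)
    (he : EnvelopingAlg φ E) (πB : DGAlgHom E B)
    extends QuasiSmoothData φ E he πB where
  quot_finite : ∀ ℓ, 1 ≤ ℓ → ∃ Q : DGModule R B,
    Nonempty (SubquotModSpec he (filt ℓ) (filt (ℓ + 1)) Q) ∧ HasFiniteSemifreeBasis Q

/-- A DG `A`-submodule of a DG `A`-module `M`: an `R`-submodule closed under the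
`A`-action and the differential and generated by homogeneous elements. -/
structure DGSubmodule {A : DGAlgebra R} (M : DGModule R A) where
  toSubmodule : Submodule R M.carrier
  smul_mem' : ∀ (x : M.carrier) (a : A.carrier), x ∈ toSubmodule →
    M.smul x a ∈ toSubmodule
  d_mem' : ∀ x ∈ toSubmodule, M.d x ∈ toSubmodule
  graded' : ∀ x ∈ toSubmodule, x ∈ Submodule.span R
    ((toSubmodule : Set M.carrier) ∩ ⋃ i : ℤ, (M.grading i : Set M.carrier))

/-- `P` (with projections `proj`) is the direct product of the family `Ms` in the
category of DG `A`-modules. -/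
def IsDGProduct {A : DGAlgebra R} (Ms : ℕ → DGModule R A) (P : DGModule R A)
    (proj : ∀ ℓ, DGHom P (Ms ℓ)) : Prop :=
  ∀ (W : DGModule R A) (f : ∀ ℓ, DGHom W (Ms ℓ)),
    ∃ g : DGHom W P, (∀ ℓ x, (proj ℓ).toFun (g.toFun x) = (f ℓ).toFun x) ∧
      ∀ g' : DGHom W P, (∀ ℓ x, (proj ℓ).toFun (g'.toFun x) = (f ℓ).toFun x) →
        ∀ x, g'.toFun x = g.toFun x

/-- `M'` is the `k`-th shift `Σ^k M` of the DG `A`-module `M`. -/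
structure DGShiftSpec {A : DGAlgebra R} (k : ℤ) (M M' : DGModule R A) where
  toFun : M.carrier → M'.carrier
  bij : Function.Bijective toFun
  map_add : ∀ x y, toFun (x + y) = toFun x + toFun y
  map_rsmul : ∀ (r : R) x, toFun (r • x) = r • toFun x
  map_mem : ∀ {i : ℤ} (x : M.carrier), x ∈ M.grading i → toFun x ∈ M'.grading (i + k)
  map_smul : ∀ (x : M.carrier) (a : A.carrier), toFun (M.smul x a) = M'.smul (toFun x) a
  map_d : ∀ x, M'.d (toFun x) = ksign k • toFun (M.d x)

/-- `C` is the mapping cone of `f : X → Y`: a degreewise split extension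
`0 → Y → C → ΣX → 0` whose twisting term is `f`. -/
structure DGConeSpec {A : DGAlgebra R} {X Y : DGModule R A} (f : DGHom X Y)
    (C : DGModule R A) where
  inl : DGHom Y C
  inl_inj : Function.Injective inl.toFun
  pr : GradedHom C X (-1)
  pr_d : ∀ c, pr.toFun (C.d c) = - X.d (pr.toFun c)
  sec : GradedHom X C 1
  pr_sec : ∀ x, pr.toFun (sec.toFun x) = x
  pr_inl : ∀ y, pr.toFun (inl.toFun y) = 0
  split : ∀ c, ∃ y, c = inl.toFun y + sec.toFun (pr.toFun c)
  sec_d : ∀ x, C.d (sec.toFun x) = - sec.toFun (X.d x) + inl.toFun (f.toFun x)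

/-- A system of divided powers on (the homogeneous elements of positive even degree
of) a DG `R`-algebra. -/
structure DGDividedPowers (A : DGAlgebra R) where
  dpow : ℕ → A.carrier → A.carrier
  dpow_zero : ∀ {i : ℤ} (u : A.carrier), 0 < i → Even i → u ∈ A.grading i →
    dpow 0 u = 1
  dpow_one : ∀ {i : ℤ} (u : A.carrier), 0 < i → Even i → u ∈ A.grading i →
    dpow 1 u = u
  dpow_mem : ∀ {i : ℤ} (u : A.carrier) (m : ℕ), 0 < i → Even i → u ∈ A.grading i →
    dpow m u ∈ A.grading ((m : ℤ) * i)
  dpow_mul : ∀ {i : ℤ} (u : A.carrier) (m l : ℕ), 0 < i → Even i → u ∈ A.grading i →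
    dpow m u * dpow l u = ((m + l).choose m : ℤ) • dpow (m + l) u
  dpow_add : ∀ {i : ℤ} (u v : A.carrier) (m : ℕ), 0 < i → Even i →
    u ∈ A.grading i → v ∈ A.grading i →
    dpow m (u + v) = ∑ j ∈ Finset.range (m + 1), dpow j u * dpow (m - j) v
  dpow_odd_mul : ∀ {i j : ℤ} (u v : A.carrier) (m : ℕ), Odd i → Odd j →
    u ∈ A.grading i → v ∈ A.grading j → 2 ≤ m → dpow m (u * v) = 0
  dpow_even_mul : ∀ {i j : ℤ} (u v : A.carrier) (m : ℕ), Even i → Even j → 0 < j →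
    u ∈ A.grading i → v ∈ A.grading j → dpow m (u * v) = u ^ m * dpow m v
  dpow_comp : ∀ {i : ℤ} (u : A.carrier) (m l : ℕ), 0 < i → Even i →
    u ∈ A.grading i → 1 ≤ m →
    dpow l (dpow m u) =
      (Nat.factorial (m * l) / (Nat.factorial l * (Nat.factorial m) ^ l)) •
        dpow (m * l) u

/-- The index set of monomials in variables `ι` (with divided/ordinary powers):
finitely supported exponent functions, with exponents at most `1` on odd-degree
variables. -/
def MonIdx (ι : Type) (degX : ι → ℤ) : Type :=
  {m : ι →₀ ℕ // ∀ i, Odd (degX i) → m i ≤ 1}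

/-- Total weight (number of symbols) of a monomial index. -/
def monWeight {ι : Type} {degX : ι → ℤ} (m : MonIdx ι degX) : ℕ :=
  m.1.sum fun _ k => k

/-- The monomial `∏_i g i (m i)` (product taken in the increasing order of the
variables). -/
def gradMonomial {T : Type} [Ring T] {ι : Type} [LinearOrder ι] (degX : ι → ℤ)
    (g : ι → ℕ → T) (m : MonIdx ι degX) : T :=
  ((m.1.support.sort (· ≤ ·)).map fun i => g i (m.1 i)).prod

/-- `B = A[X_i : i ∈ ι]` is a polynomial extension of `A` by the variables `X_i`
of positive degrees `degX i`, adjoined in increasing order of degree, each `d X_i`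
lying in the preceding stage; the monomials in the `X_i` form a basis of `B` as a
graded `A`-module. -/
structure PolyExt {A B : DGAlgebra R} (φ : DGAlgHom A B) (ι : Type) [LinearOrder ι]
    (X : ι → B.carrier) (degX : ι → ℤ) where
  inj : Function.Injective φ.toFun
  pos_deg : ∀ i, 0 < degX i
  mono_deg : Monotone degX
  homog : ∀ i, X i ∈ B.grading (degX i)
  d_prev : ∀ i : ι, ∃ c : MonIdx ι degX →₀ A.carrier,
    (∀ m ∈ c.support, ∀ j : ι, i ≤ j → m.1 j = 0) ∧
    B.d (X i) = c.sum fun m a =>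
      gradMonomial degX (fun i' k => X i' ^ k) m * φ.toFun a
  basis : Function.Bijective (fun c : MonIdx ι degX →₀ A.carrier =>
    c.sum fun m a => gradMonomial degX (fun i' k => X i' ^ k) m * φ.toFun a)

/-- `B = A⟨X_i : i ∈ ι⟩` is a free (divided power) extension of `A` by the
variables `X_i` of positive degrees: odd variables square to zero, even variables
carry divided powers `dp i m` with `d(X^{(m)}) = X^{(m-1)} dX`, and the divided
power monomials form a basis of `B` as a graded `A`-module. -/
structure FreeExt {A B : DGAlgebra R} (φ : DGAlgHom A B) (ι : Type) [LinearOrder ι]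
    (X : ι → B.carrier) (degX : ι → ℤ) where
  inj : Function.Injective φ.toFun
  pos_deg : ∀ i, 0 < degX i
  mono_deg : Monotone degX
  homog : ∀ i, X i ∈ B.grading (degX i)
  dp : ι → ℕ → B.carrier
  dp_zero : ∀ i, dp i 0 = 1
  dp_one : ∀ i, dp i 1 = X i
  dp_odd : ∀ i m, Odd (degX i) → 2 ≤ m → dp i m = 0
  dp_mem : ∀ i (m : ℕ), dp i m ∈ B.grading ((m : ℤ) * degX i)
  dp_mul : ∀ i (m l : ℕ), dp i m * dp i l = ((m + l).choose m : ℤ) • dp i (m + l)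
  dp_d : ∀ i (m : ℕ), 1 ≤ m → B.d (dp i m) = dp i (m - 1) * B.d (X i)
  d_prev : ∀ i : ι, ∃ c : MonIdx ι degX →₀ A.carrier,
    (∀ m ∈ c.support, ∀ j : ι, i ≤ j → m.1 j = 0) ∧
    B.d (X i) = c.sum fun m a => gradMonomial degX dp m * φ.toFun a
  basis : Function.Bijective (fun c : MonIdx ι degX →₀ A.carrier =>
    c.sum fun m a => gradMonomial degX dp m * φ.toFun a)

/-- The diagonal `ξ_i = X_i^o ⊗ 1 - 1^o ⊗ X_i` of the variable `X_i` in `B^e`. -/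
def xiDiag {A B E : DGAlgebra R} {φ : DGAlgHom A B} (he : EnvelopingAlg φ E)
    {ι : Type} (X : ι → B.carrier) (i : ι) : E.carrier :=
  he.l.toFun (X i) - he.r.toFun (X i)

/-- The divided powers `ξ_i^{(m)} = Σ_{j=0}^m (-1)^{m-j} (X_i^{(j)})^o ⊗ X_i^{(m-j)}`
of the diagonal `ξ_i` in `B^e` (zero for `m ≥ 2` when `|X_i|` is odd). -/
def xiDp {A B E : DGAlgebra R} {φ : DGAlgHom A B} (he : EnvelopingAlg φ E)
    {ι : Type} (dp : ι → ℕ → B.carrier) (degX : ι → ℤ) (i : ι) (m : ℕ) :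
    E.carrier :=
  if Odd (degX i) ∧ 2 ≤ m then 0
  else ∑ j ∈ Finset.range (m + 1),
    ((-1 : ℤ) ^ (m - j)) • (he.l.toFun (dp i j) * he.r.toFun (dp i (m - j)))

/-- The monomial `ξ^{(m)} = ξ_{i_1}^{(m_{i_1})} ⋯ ξ_{i_t}^{(m_{i_t})}` in `B^e`
built from the divided powers of the diagonals. -/
def FreeExt.diagMon {A B E : DGAlgebra R} {φ : DGAlgHom A B}
    {ι : Type} [LinearOrder ι] {X : ι → B.carrier} {degX : ι → ℤ}
    (fe : FreeExt φ ι X degX) (he : EnvelopingAlg φ E) (m : MonIdx ι degX) :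
    E.carrier :=
  gradMonomial degX (xiDp he fe.dp degX) m

/-- The `ℓ`-th power `J^{(ℓ)} = Mon_{≥ℓ}(Ω)·B^e` of the diagonal ideal:
right `B^e`-linear combinations of the `ξ`-monomials of weight at least `ℓ`. -/
def FreeExt.diagPow {A B E : DGAlgebra R} {φ : DGAlgHom A B}
    {ι : Type} [LinearOrder ι] {X : ι → B.carrier} {degX : ι → ℤ}
    (fe : FreeExt φ ι X degX) (he : EnvelopingAlg φ E) (ℓ : ℕ) :
    Set E.carrier :=
  {x | ∃ c : MonIdx ι degX →₀ E.carrier, (∀ m ∈ c.support, ℓ ≤ monWeight m) ∧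
    x = c.sum fun m e => fe.diagMon he m * e}

/-- Ordinary-power analogue `J^ℓ` for polynomial extensions. -/
def PolyExt.diagPow {A B E : DGAlgebra R} {φ : DGAlgHom A B}
    {ι : Type} [LinearOrder ι] {X : ι → B.carrier} {degX : ι → ℤ}
    (_ : PolyExt φ ι X degX) (he : EnvelopingAlg φ E) (ℓ : ℕ) :
    Set E.carrier :=
  {x | ∃ c : MonIdx ι degX →₀ E.carrier, (∀ m ∈ c.support, ℓ ≤ monWeight m) ∧
    x = c.sum fun m e =>
      gradMonomial degX (fun i k => (xiDiag he X i) ^ k) m * e}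

/-- Additive closure of the set of products `a * b` with `a ∈ S₁`, `b ∈ S₂`. -/
def setMulClosure {T : Type} [Ring T] (S₁ S₂ : Set T) : Set T :=
  (AddSubmonoid.closure {x | ∃ a ∈ S₁, ∃ b ∈ S₂, x = a * b} : AddSubmonoid T)

/-- The right ideal generated by a set. -/
def rightIdealGen {T : Type} [Ring T] (S : Set T) : Set T :=
  (AddSubmonoid.closure {x | ∃ s ∈ S, ∃ e : T, x = s * e} : AddSubmonoid T)

/-- The two-sided ideal generated by a set. -/
def twoSidedGen {T : Type} [Ring T] (S : Set T) : Set T :=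
  (AddSubmonoid.closure {x | ∃ s ∈ S, ∃ e e' : T, x = e * s * e'} : AddSubmonoid T)

end

noncomputable section

variable {R : Type} [CommRing R]

theorem ksign_add (i j : ℤ) : ksign (i + j) = ksign i * ksign j := by
  simp [ksign, zpow_add]

theorem ksign_of_even {i : ℤ} (h : Even i) : ksign i = 1 := by
  simp [ksign, h.neg_one_zpow]

theorem ksign_congr {i j : ℤ} (h : Even (i - j)) : ksign i = ksign j := by
  have := ksign_add (i - j) j
  rwa [sub_add_cancel, ksign_of_even h, one_mul] at this

theorem ksign_mul_self (i : ℤ) : ksign i * ksign i = 1 := by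
  rw [← ksign_add, ksign_of_even ⟨i, rfl⟩]

theorem ksign_one : ksign 1 = -1 := by simp [ksign]

theorem ksign_sub_one (i : ℤ) : ksign (i - 1) = -ksign i := by
  rw [ksign_congr (j := i + 1) ⟨-1, by ring⟩, ksign_add, ksign_one, mul_neg_one]

section Grading

variable {M : Type} [AddCommGroup M] [Module R M] {G : ℤ → Submodule R M}

theorem isCompl_grading (hi : ∀ i, Disjoint (G i) (⨆ j ≠ i, G j)) (hs : ⨆ i, G i = ⊤) (i : ℤ) :
    IsCompl (G i) (⨆ j ≠ i, G j) := by
  refine ⟨hi i, codisjoint_iff_le_sup.2 ?_⟩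
  rw [← hs]
  refine iSup_le fun j => ?_
  rcases eq_or_ne j i with rfl | h
  · exact le_sup_left
  · exact le_sup_of_le_right (le_iSup₂_of_le j h le_rfl)

/-- The projection onto the homogeneous component of degree `i`. -/
def homComp (hi : ∀ i, Disjoint (G i) (⨆ j ≠ i, G j)) (hs : ⨆ i, G i = ⊤) (i : ℤ) : M →ₗ[R] M :=
  (G i).projection _ (isCompl_grading hi hs i)

variable (hi : ∀ i, Disjoint (G i) (⨆ j ≠ i, G j)) (hs : ⨆ i, G i = ⊤)

theorem homComp_mem (i : ℤ) (x : M) : homComp hi hs i x ∈ G i :=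
  Submodule.projection_apply_mem _ x

theorem homComp_of_mem {i : ℤ} {x : M} (hx : x ∈ G i) : homComp hi hs i x = x :=
  Submodule.projection_apply_of_mem_left _ hx

theorem homComp_of_ne {i j : ℤ} (h : j ≠ i) {x : M} (hx : x ∈ G j) : homComp hi hs i x = 0 :=
  (Submodule.projection_apply_eq_zero_iff _).2 (Submodule.mem_iSup_of_mem j
    (Submodule.mem_iSup_of_mem h hx))

theorem homogeneous_induction (hs : ⨆ i, G i = ⊤) {p : M → Prop} (x : M) (hom : ∀ i, ∀ x ∈ G i, p x)
    (add : ∀ x y, p x → p y → p (x + y)) : p x :=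
  Submodule.iSup_induction (motive := p) G (hs ▸ Submodule.mem_top : x ∈ ⨆ i, G i) hom
    (hom 0 0 (zero_mem _)) add

theorem disjoint_grading_of_components (π : ℤ → M →ₗ[R] M) (h₁ : ∀ i, ∀ x ∈ G i, π i x = x)
    (h₂ : ∀ i j, j ≠ i → ∀ x ∈ G j, π i x = 0) (i : ℤ) : Disjoint (G i) (⨆ j ≠ i, G j) := by
  rw [Submodule.disjoint_def]
  intro x hx hx'
  rw [← h₁ i x hx]
  have : (⨆ j ≠ i, G j) ≤ LinearMap.ker (π i) :=
    iSup₂_le fun j hj y hy => h₂ i j hj y hy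
  exact this hx'

end Grading

/-- The homogeneous components of elements of a DG algebra. -/
abbrev DGAlgebra.comp (A : DGAlgebra R) (i : ℤ) : A.carrier →ₗ[R] A.carrier :=
  homComp A.indep A.spanning i

/-- The homogeneous components of elements of a DG module. -/
abbrev DGModule.comp {A : DGAlgebra R} (M : DGModule R A) (i : ℤ) : M.carrier →ₗ[R] M.carrier :=
  homComp M.indep M.spanning i

/-- The differential of a DG algebra as a linear map. -/
def DGAlgebra.dLin (A : DGAlgebra R) : A.carrier →ₗ[R] A.carrier where
  toFun := A.d
  map_add' := A.d_add
  map_smul' := A.d_rsmul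

@[simp] theorem DGAlgebra.dLin_apply (A : DGAlgebra R) (a : A.carrier) : A.dLin a = A.d a := rfl

/-- A homomorphism of DG algebras as a linear map. -/
def DGAlgHom.lin {A B : DGAlgebra R} (f : DGAlgHom A B) : A.carrier →ₗ[R] B.carrier where
  toFun := f.toFun
  map_add' := f.map_add
  map_smul' := f.map_rsmul

@[simp] theorem DGAlgHom.lin_apply {A B : DGAlgebra R} (f : DGAlgHom A B) (a : A.carrier) :
    f.lin a = f.toFun a := rfl

namespace DGModule

variable {A : DGAlgebra R} (M : DGModule R A)

/-- The differential of a DG module as a linear map. -/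
def dLin : M.carrier →ₗ[R] M.carrier where
  toFun := M.d
  map_add' := M.d_add
  map_smul' := M.d_rsmul

@[simp] theorem dLin_apply (m : M.carrier) : M.dLin m = M.d m := rfl

theorem d_zsmul (z : ℤ) (m : M.carrier) : M.d (z • m) = z • M.d m := map_zsmul M.dLin z m

/-- The action on a DG module as a bilinear map. -/
def act : M.carrier →ₗ[R] A.carrier →ₗ[R] M.carrier :=
  LinearMap.mk₂ R M.smul M.add_smul (fun r m a => M.rsmul_smul r m a) M.smul_add
    fun r m a => M.smul_rsmul r m a

@[simp] theorem act_apply (m : M.carrier) (a : A.carrier) : M.act m a = M.smul m a := rfl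

theorem zsmul_smul (z : ℤ) (m : M.carrier) (a : A.carrier) :
    M.smul (z • m) a = z • M.smul m a :=
  map_zsmul (M.act.flip a) z m

theorem smul_zsmul (z : ℤ) (m : M.carrier) (a : A.carrier) :
    M.smul m (z • a) = z • M.smul m a := map_zsmul (M.act m) z a

end DGModule

namespace GradedHom

variable {A : DGAlgebra R} {M N : DGModule R A} {k : ℤ}

/-- A graded homomorphism as a linear map. -/
def lin (f : GradedHom M N k) : M.carrier →ₗ[R] N.carrier where
  toFun := f.toFun
  map_add' := f.map_add
  map_smul' := f.map_rsmul

@[simp] theorem lin_apply (f : GradedHom M N k) (x : M.carrier) : f.lin x = f.toFun x := rfl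

end GradedHom

/-- A homomorphism of DG modules as a linear map. -/
def DGHom.lin {A : DGAlgebra R} {M N : DGModule R A} (f : DGHom M N) :
    M.carrier →ₗ[R] N.carrier where
  toFun := f.toFun
  map_add' := f.map_add
  map_smul' := f.map_rsmul

@[simp] theorem DGHom.lin_apply {A : DGAlgebra R} {M N : DGModule R A} (f : DGHom M N)
    (x : M.carrier) : f.lin x = f.toFun x := rfl

namespace SemifreeBasisOn

variable {A : DGAlgebra R} {N : DGModule R A} {κ : Type} {e : κ → N.carrier}

/-- The isomorphism from finitely supported families of coefficients given by a basis. -/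
def equiv (sb : SemifreeBasisOn N e) : (κ →₀ A.carrier) ≃ₗ[R] N.carrier :=
  LinearEquiv.ofBijective (Finsupp.lsum R fun k => N.act (e k)) sb.basis

/-- The coordinates of an element with respect to a basis. -/
def coords (sb : SemifreeBasisOn N e) : N.carrier →ₗ[R] κ →₀ A.carrier := sb.equiv.symm

variable (sb : SemifreeBasisOn N e)

theorem equiv_apply (c : κ →₀ A.carrier) : sb.equiv c = c.sum fun k a => N.smul (e k) a := rfl

@[simp] theorem equiv_single (k : κ) (a : A.carrier) :
    sb.equiv (Finsupp.single k a) = N.smul (e k) a := by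
  rw [equiv_apply, Finsupp.sum_single_index]
  exact map_zero (N.act (e k))

@[simp] theorem coords_equiv (c : κ →₀ A.carrier) : sb.coords (sb.equiv c) = c :=
  sb.equiv.symm_apply_apply c

@[simp] theorem equiv_coords (n : N.carrier) : sb.equiv (sb.coords n) = n :=
  sb.equiv.apply_symm_apply n

theorem coords_injective {m n : N.carrier} (h : ∀ k, sb.coords m k = sb.coords n k) : m = n :=
  sb.equiv.symm.injective (Finsupp.ext h)

@[simp] theorem coords_smul_basis (k : κ) (a : A.carrier) :
    sb.coords (N.smul (e k) a) = Finsupp.single k a := by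
  rw [← equiv_single, coords_equiv]

@[simp] theorem coords_basis (k : κ) : sb.coords (e k) = Finsupp.single k 1 := by
  rw [← coords_smul_basis, N.smul_one]

/-- To prove a statement about all elements, it suffices to treat homogeneous multiples of
basis elements. -/
theorem induction (sb : SemifreeBasisOn N e) {p : N.carrier → Prop} (n : N.carrier)
    (hom : ∀ k j, ∀ a ∈ A.grading j, p (N.smul (e k) a))
    (add : ∀ x y, p x → p y → p (x + y)) (zero : p 0) : p n := by
  rw [← sb.equiv_coords n]
  induction sb.coords n using Finsupp.induction_linear with
  | zero => simpa using zero
  | add f g hf hg => rw [map_add]; exact add _ _ hf hg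
  | single k a =>
    rw [equiv_single]
    refine homogeneous_induction (p := fun a => p (N.smul (e k) a)) A.spanning a (hom k) ?_
    intro x y hx hy
    rw [N.smul_add]
    exact add _ _ hx hy

theorem coords_smul (n : N.carrier) (a : A.carrier) (k : κ) :
    sb.coords (N.smul n a) k = sb.coords n k * a := by
  refine sb.induction (p := fun n => sb.coords (N.smul n a) k = sb.coords n k * a) n
    (fun j i b _ => ?_) (fun x y hx hy => ?_) ?_
  · rw [N.smul_mul]
    by_cases h : j = k <;> simp [h]
  · rw [N.add_smul, map_add, map_add, Finsupp.add_apply, Finsupp.add_apply, hx, hy, add_mul]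
  · have : N.smul 0 a = 0 := LinearMap.map_zero₂ N.act a
    simp [this]

theorem coords_comp (i : ℤ) (n : N.carrier) (k : κ) :
    sb.coords (N.comp i n) k = A.comp (i - sb.deg k) (sb.coords n k) := by
  refine sb.induction
    (p := fun n => sb.coords (N.comp i n) k = A.comp (i - sb.deg k) (sb.coords n k)) n
    (fun j m b hb => ?_) (fun x y hx hy => ?_) (by simp)
  · have hm := N.smul_mem (sb.homog j) hb
    by_cases h : sb.deg j + m = i
    · rw [homComp_of_mem _ _ (h ▸ hm), coords_smul_basis]
      by_cases hk : j = k
      · subst hk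
        rw [Finsupp.single_eq_same, homComp_of_mem]
        rwa [← h, add_sub_cancel_left]
      · simp [Finsupp.single_eq_of_ne' hk]
    · rw [homComp_of_ne _ _ h hm, coords_smul_basis]
      by_cases hk : j = k
      · subst hk
        rw [Finsupp.single_eq_same, homComp_of_ne _ _ _ hb]
        · simp
        · omega
      · simp [Finsupp.single_eq_of_ne' hk]
  · simp only [map_add, Finsupp.add_apply, hx, hy]

theorem coords_mem {i : ℤ} {n : N.carrier} (hn : n ∈ N.grading i) (k : κ) :
    sb.coords n k ∈ A.grading (i - sb.deg k) := by
  rw [← homComp_of_mem N.indep N.spanning hn, coords_comp]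
  exact homComp_mem _ _ _ _

theorem coords_d (n : N.carrier) (k : κ) :
    sb.coords (N.d n) k =
      ((sb.coords n).sum fun j a => sb.coords (N.d (e j)) k * a) +
        ksign (sb.deg k) • A.d (sb.coords n k) := by
  refine sb.induction (p := fun n => sb.coords (N.d n) k =
    ((sb.coords n).sum fun j a => sb.coords (N.d (e j)) k * a) +
      ksign (sb.deg k) • A.d (sb.coords n k)) n (fun j m b hb => ?_) (fun x y hx hy => ?_) ?_
  · rw [N.leibniz _ _ (sb.homog j), map_add, map_zsmul, coords_smul_basis, coords_smul_basis,
      Finsupp.sum_single_index (by simp), Finsupp.add_apply, coords_smul]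
    by_cases hk : j = k
    · subst hk; simp
    · have : A.d 0 = 0 := map_zero A.dLin
      simp [Finsupp.single_eq_of_ne' hk, this]
  · rw [N.d_add, map_add, map_add, Finsupp.add_apply, Finsupp.add_apply, hx, hy, A.d_add,
      Finsupp.sum_add_index' (by simp) (fun _ _ _ => mul_add _ _ _), smul_add]
    abel
  · have h₁ : N.d 0 = 0 := map_zero N.dLin
    have h₂ : A.d 0 = 0 := map_zero A.dLin
    simp [h₁, h₂]

/-- Two linear maps compatible with the actions that agree on a basis are equal. -/
theorem eq_of_eq_on_basis (sb : SemifreeBasisOn N e) {W : Type} [AddCommGroup W] [Module R W]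
    (act : A.carrier → W →ₗ[R] W) {f g : N.carrier →ₗ[R] W}
    (hf : ∀ n a, f (N.smul n a) = act a (f n)) (hg : ∀ n a, g (N.smul n a) = act a (g n))
    (h : ∀ k, f (e k) = g (e k)) : f = g := by
  ext n
  exact sb.induction (p := fun n => f n = g n) n (fun k j a _ => by rw [hf, hg, h])
    (fun x y hx hy => by rw [map_add, map_add, hx, hy]) (by simp)

end SemifreeBasisOn

end

noncomputable section

variable {R : Type} [CommRing R]

namespace SemifreeBasisOn

variable {B : DGAlgebra R} {N : DGModule R B} {κ : Type} {e : κ → N.carrier}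

/-- To prove a statement about elements of degree `i`, it suffices to treat homogeneous multiples
of basis elements. -/
theorem induction_of_mem (sb : SemifreeBasisOn N e) {i : ℤ} {p : N.carrier → Prop}
    {n : N.carrier} (hn : n ∈ N.grading i)
    (hom : ∀ k, ∀ b ∈ B.grading (i - sb.deg k), p (N.smul (e k) b))
    (add : ∀ x y, p x → p y → p (x + y)) (zero : p 0) : p n := by
  rw [← sb.equiv_coords n, sb.equiv_apply]
  exact Finset.sum_induction _ p add zero fun k _ => hom k _ (sb.coords_mem hn k)

end SemifreeBasisOn

theorem Finsupp.submodule_induction {M κ : Type} [AddCommGroup M] [Module R M]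
    {S : κ → Submodule R M} {p : (κ →₀ M) → Prop} {t : κ →₀ M} (ht : t ∈ Finsupp.submodule S)
    (single : ∀ k, ∀ x ∈ S k, p (Finsupp.single k x))
    (add : ∀ t ∈ Finsupp.submodule S, ∀ u ∈ Finsupp.submodule S, p t → p u → p (t + u))
    (zero : p 0) : p t := by
  suffices h : t ∈ Finsupp.submodule S ∧ p t from h.2
  rw [← Finsupp.sum_single t]
  refine Finset.sum_induction _ (fun t => t ∈ Finsupp.submodule S ∧ p t)
    (fun t u h h' => ⟨add_mem h.1 h'.1, add _ h.1 _ h'.1 h.2 h'.2⟩) ⟨zero_mem _, zero⟩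
    fun k _ => ⟨?_, single k _ ((Finsupp.mem_submodule_iff _ _).1 ht k)⟩
  rw [Finsupp.mem_submodule_iff]
  intro j
  by_cases h : k = j
  · subst h; simpa using (Finsupp.mem_submodule_iff _ _).1 ht k
  · simp [Finsupp.single_eq_of_ne' h]

/-! The base change `N ⊗_B E` of a semifree DG `B`-module along `l : B → E`, in coordinates with
respect to a semifree basis of `N`. Its underlying module is `κ →₀ E`, and `B` acts on it from the
right through a second homomorphism `r : B → E`. -/

section Tensor

variable {B E : DGAlgebra R} {N : DGModule R B} {κ : Type} {e : κ → N.carrier}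

theorem DGAlgHom.map_zero (l : DGAlgHom B E) : l.toFun 0 = 0 := _root_.map_zero l.lin

theorem DGAlgHom.map_zsmul (l : DGAlgHom B E) (z : ℤ) (b : B.carrier) :
    l.toFun (z • b) = z • l.toFun b := _root_.map_zsmul l.lin z b

/-- The right action of `B` on `κ →₀ E` through `r : B → E`. -/
def tensorAct (κ : Type) (r : DGAlgHom B E) :
    B.carrier →ₗ[R] (κ →₀ E.carrier) →ₗ[R] κ →₀ E.carrier :=
  LinearMap.mk₂ R (fun b t => t.mapRange (fun x => x * r.toFun b) (zero_mul _))
    (fun b c t => by ext k; simp [r.map_add, mul_add])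
    (fun c b t => by ext k; simp [r.map_rsmul])
    (fun b t u => by ext k; simp [add_mul])
    (fun c b t => by ext k; simp)

@[simp] theorem tensorAct_apply (r : DGAlgHom B E) (b : B.carrier) (t : κ →₀ E.carrier) (k : κ) :
    tensorAct κ r b t k = t k * r.toFun b := rfl

theorem tensorAct_single (r : DGAlgHom B E) (b : B.carrier) (k : κ) (x : E.carrier) :
    tensorAct κ r b (Finsupp.single k x) = Finsupp.single k (x * r.toFun b) :=
  Finsupp.mapRange_single (f := fun x => x * r.toFun b) (hf := zero_mul _)

theorem tensorAct_tensorAct (r : DGAlgHom B E) (b c : B.carrier) (t : κ →₀ E.carrier) :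
    tensorAct κ r c (tensorAct κ r b t) = tensorAct κ r (b * c) t := by
  ext k; simp [r.map_mul, mul_assoc]

/-- The elements of `N ⊗_B E` with all coordinates in `S`. -/
abbrev tensorSub (κ : Type) (S : Submodule R E.carrier) : Submodule R (κ →₀ E.carrier) :=
  Finsupp.submodule fun _ => S

theorem tensorAct_mem {S : Submodule R E.carrier} {r : DGAlgHom B E}
    (hS : ∀ b, ∀ x ∈ S, x * r.toFun b ∈ S) {t : κ →₀ E.carrier} (ht : t ∈ tensorSub κ S)
    (b : B.carrier) : tensorAct κ r b t ∈ tensorSub κ S :=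
  (Finsupp.mem_submodule_iff _ _).2 fun k => hS b _ ((Finsupp.mem_submodule_iff _ _).1 ht k)

namespace SemifreeBasisOn

variable (sb : SemifreeBasisOn N e) (l r : DGAlgHom B E)

/-- The pairing `N × E → N ⊗_B E`. -/
def tensorPair : N.carrier →ₗ[R] E.carrier →ₗ[R] κ →₀ E.carrier :=
  LinearMap.mk₂ R
    (fun n x => (sb.coords n).mapRange (fun b => l.toFun b * x) (by rw [l.map_zero, zero_mul]))
    (fun b c t => by ext k; simp [l.map_add, add_mul])
    (fun c b t => by ext k; simp [l.map_rsmul])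
    (fun b t u => by ext k; simp [mul_add])
    (fun c b t => by ext k; simp)

@[simp] theorem tensorPair_apply (n : N.carrier) (x : E.carrier) (k : κ) :
    sb.tensorPair l n x k = l.toFun (sb.coords n k) * x := rfl

theorem tensorPair_smul (n : N.carrier) (b : B.carrier) (x : E.carrier) :
    sb.tensorPair l (N.smul n b) x = sb.tensorPair l n (l.toFun b * x) := by
  ext k; simp [coords_smul, l.map_mul, mul_assoc]

theorem tensorPair_mul (n : N.carrier) (x : E.carrier) (b : B.carrier) :
    sb.tensorPair l n (x * r.toFun b) = tensorAct κ r b (sb.tensorPair l n x) := by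
  ext k; simp [mul_assoc]

theorem tensorPair_basis (k : κ) (x : E.carrier) :
    sb.tensorPair l (e k) x = Finsupp.single k x := by
  classical
  ext j
  rw [tensorPair_apply, coords_basis, Finsupp.single_apply, Finsupp.single_apply]
  split_ifs
  · rw [l.map_one, one_mul]
  · rw [l.map_zero, zero_mul]

theorem tensorPair_smul_basis (k : κ) (b : B.carrier) (x : E.carrier) :
    sb.tensorPair l (N.smul (e k) b) x = Finsupp.single k (l.toFun b * x) := by
  rw [tensorPair_smul, tensorPair_basis]

theorem tensorPair_mem {S : Submodule R E.carrier} (hS : ∀ b, ∀ x ∈ S, l.toFun b * x ∈ S)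
    (n : N.carrier) {x : E.carrier} (hx : x ∈ S) : sb.tensorPair l n x ∈ tensorSub κ S :=
  (Finsupp.mem_submodule_iff _ _).2 fun _ => hS _ _ hx

/-- The homogeneous elements of degree `i` of `N ⊗_B E`. -/
def tensorGrading (E : DGAlgebra R) (i : ℤ) : Submodule R (κ →₀ E.carrier) :=
  Finsupp.submodule fun k => E.grading (i - sb.deg k)

theorem mem_tensorGrading {i : ℤ} {t : κ →₀ E.carrier} :
    t ∈ sb.tensorGrading E i ↔ ∀ k, t k ∈ E.grading (i - sb.deg k) :=
  Finsupp.mem_submodule_iff _ _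

theorem single_mem_tensorGrading {i : ℤ} {k : κ} {x : E.carrier}
    (hx : x ∈ E.grading (i - sb.deg k)) : Finsupp.single k x ∈ sb.tensorGrading E i := by
  rw [mem_tensorGrading]
  intro j
  by_cases h : k = j
  · subst h; simpa using hx
  · simp [Finsupp.single_eq_of_ne' h]

theorem tensorPair_mem_grading {i j : ℤ} {n : N.carrier} {x : E.carrier} (hn : n ∈ N.grading i)
    (hx : x ∈ E.grading j) : sb.tensorPair l n x ∈ sb.tensorGrading E (i + j) := by
  rw [mem_tensorGrading]
  intro k
  rw [tensorPair_apply, add_sub_right_comm]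
  exact E.mul_mem (l.map_mem (sb.coords_mem hn k)) hx

theorem tensorAct_mem_grading {i j : ℤ} {t : κ →₀ E.carrier} {b : B.carrier}
    (ht : t ∈ sb.tensorGrading E i) (hb : b ∈ B.grading j) :
    tensorAct κ r b t ∈ sb.tensorGrading E (i + j) := by
  rw [mem_tensorGrading] at ht ⊢
  intro k
  rw [tensorAct_apply, add_sub_right_comm]
  exact E.mul_mem (ht k) (r.map_mem hb)

/-- The homogeneous components of elements of `N ⊗_B E`. -/
def tensorComp (E : DGAlgebra R) (i : ℤ) : (κ →₀ E.carrier) →ₗ[R] κ →₀ E.carrier :=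
  Finsupp.lsum R fun k => Finsupp.lsingle k ∘ₗ E.comp (i - sb.deg k)

theorem tensorComp_apply (i : ℤ) (t : κ →₀ E.carrier) (k : κ) :
    sb.tensorComp E i t k = E.comp (i - sb.deg k) (t k) := by
  induction t using Finsupp.induction_linear with
  | zero => simp
  | add f g hf hg => simp only [map_add, Finsupp.add_apply, hf, hg]
  | single j x =>
    by_cases h : j = k
    · subst h; simp [tensorComp]
    · simp [tensorComp, Finsupp.single_eq_of_ne' h]

/-- The differential of `N ⊗_B E`. -/
def tensorD : (κ →₀ E.carrier) →ₗ[R] κ →₀ E.carrier :=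
  Finsupp.lsum R fun k =>
    sb.tensorPair l (N.d (e k)) + ksign (sb.deg k) • (Finsupp.lsingle k ∘ₗ E.dLin)

theorem tensorD_single (k : κ) (x : E.carrier) :
    sb.tensorD l (Finsupp.single k x) =
      sb.tensorPair l (N.d (e k)) x + ksign (sb.deg k) • Finsupp.single k (E.d x) := by
  rw [tensorD, Finsupp.lsum_single]
  rfl

theorem tensorD_pair {i : ℤ} {n : N.carrier} (hn : n ∈ N.grading i) (x : E.carrier) :
    sb.tensorD l (sb.tensorPair l n x) =
      sb.tensorPair l (N.d n) x + ksign i • sb.tensorPair l n (E.d x) := by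
  refine sb.induction_of_mem (p := fun n => sb.tensorD l (sb.tensorPair l n x) =
    sb.tensorPair l (N.d n) x + ksign i • sb.tensorPair l n (E.d x)) hn (fun k b hb => ?_)
    (fun m n hm hn => ?_) ?_
  · rw [tensorPair_smul_basis, tensorD_single, N.leibniz _ _ (sb.homog k), map_add, map_zsmul,
      LinearMap.add_apply, LinearMap.smul_apply, tensorPair_smul, tensorPair_smul_basis,
      tensorPair_smul_basis, E.leibniz _ _ (l.map_mem hb), ← l.comm_d, Finsupp.single_add,
      smul_add, add_assoc, ← Finsupp.smul_single, smul_smul, ← ksign_add, add_sub_cancel]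
  · rw [map_add, LinearMap.add_apply, map_add, hm, hn, N.d_add, map_add, LinearMap.add_apply,
      LinearMap.add_apply, smul_add]
    abel
  · have : N.d 0 = 0 := map_zero N.dLin
    simp [this]

theorem tensorD_sq (t : κ →₀ E.carrier) : sb.tensorD l (sb.tensorD l t) = 0 := by
  induction t using Finsupp.induction_linear with
  | zero => simp
  | add f g hf hg => rw [map_add, map_add, hf, hg, add_zero]
  | single k x =>
    rw [tensorD_single, map_add, map_zsmul, tensorD_pair sb l (N.d_mem (sb.homog k)), N.d_sq,
      tensorD_single, E.d_sq, ksign_sub_one]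
    simp

theorem tensorD_act {i : ℤ} {t : κ →₀ E.carrier} (ht : t ∈ sb.tensorGrading E i)
    (b : B.carrier) : sb.tensorD l (tensorAct κ r b t) =
      tensorAct κ r b (sb.tensorD l t) + ksign i • tensorAct κ r (B.d b) t := by
  refine Finsupp.submodule_induction (p := fun t => sb.tensorD l (tensorAct κ r b t) =
      tensorAct κ r b (sb.tensorD l t) + ksign i • tensorAct κ r (B.d b) t) ht
    (fun k x hx => ?_) (fun t _ u _ ht hu => ?_) (by simp)
  · rw [tensorAct_single, tensorD_single, tensorD_single, map_add, map_zsmul, tensorPair_mul,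
      tensorAct_single, tensorAct_single, E.leibniz _ _ hx, Finsupp.single_add, smul_add,
      ← Finsupp.smul_single, smul_smul, ← ksign_add, add_sub_cancel, r.comm_d, add_assoc]
  · simp only [map_add, smul_add, ht, hu]
    abel

theorem tensorD_mem_grading {i : ℤ} {t : κ →₀ E.carrier} (ht : t ∈ sb.tensorGrading E i) :
    sb.tensorD l t ∈ sb.tensorGrading E (i - 1) := by
  refine Finsupp.submodule_induction (p := fun t => sb.tensorD l t ∈ sb.tensorGrading E (i - 1))
    ht (fun k x hx => ?_) (fun t _ u _ ht hu => ?_) (by simp)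
  · rw [tensorD_single]
    refine add_mem ?_ (zsmul_mem (sb.single_mem_tensorGrading ?_) _)
    · have := sb.tensorPair_mem_grading l (N.d_mem (sb.homog k)) hx
      rwa [show sb.deg k - 1 + (i - sb.deg k) = i - 1 by ring] at this
    · rw [sub_right_comm]
      exact E.d_mem hx
  · rw [map_add]
    exact add_mem ht hu

theorem tensorD_mem {S : Submodule R E.carrier} (hS : ∀ b, ∀ x ∈ S, l.toFun b * x ∈ S)
    (hd : ∀ x ∈ S, E.d x ∈ S) {t : κ →₀ E.carrier} (ht : t ∈ tensorSub κ S) :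
    sb.tensorD l t ∈ tensorSub κ S := by
  refine Finsupp.submodule_induction (p := fun t => sb.tensorD l t ∈ tensorSub κ S)
    ht (fun k x hx => ?_) (fun t _ u _ ht hu => ?_) (by simp)
  · rw [tensorD_single, ← sb.tensorPair_basis l]
    exact add_mem (sb.tensorPair_mem l hS _ hx) (zsmul_mem (sb.tensorPair_mem l hS _ (hd x hx)) _)
  · rw [map_add]
    exact add_mem ht hu

/-- A graded `B`-linear map of degree `d` from `N` to `N ⊗_B E`. -/
structure TensorHom (sb : SemifreeBasisOn N e) (r : DGAlgHom B E) (d : ℤ) where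
  lin : N.carrier →ₗ[R] κ →₀ E.carrier
  map_act : ∀ n b, lin (N.smul n b) = tensorAct κ r b (lin n)
  map_mem : ∀ {i n}, n ∈ N.grading i → lin n ∈ sb.tensorGrading E (i + d)

/-- The graded `B`-linear map with prescribed values on the basis. -/
def TensorHom.ofBasis {d : ℤ} (t : κ → κ →₀ E.carrier)
    (ht : ∀ k, t k ∈ sb.tensorGrading E (sb.deg k + d)) : TensorHom sb r d where
  lin := (Finsupp.lsum R fun k => (tensorAct κ r).flip (t k)) ∘ₗ sb.coords
  map_act n b := by
    refine sb.induction (p := fun n => ((Finsupp.lsum R fun k => (tensorAct κ r).flip (t k)) ∘ₗ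
      sb.coords) (N.smul n b) = tensorAct κ r b (((Finsupp.lsum R fun k =>
        (tensorAct κ r).flip (t k)) ∘ₗ sb.coords) n)) n (fun k j a _ => ?_) (fun x y hx hy => ?_) ?_
    · rw [N.smul_mul, LinearMap.comp_apply, LinearMap.comp_apply, coords_smul_basis,
        coords_smul_basis, Finsupp.lsum_single, Finsupp.lsum_single, LinearMap.flip_apply,
        LinearMap.flip_apply, tensorAct_tensorAct]
    · rw [N.add_smul, map_add, map_add, map_add, hx, hy]
    · have : N.smul 0 b = 0 := LinearMap.map_zero₂ N.act b
      simp [this]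
  map_mem {i n} hn := by
    refine sb.induction_of_mem (p := fun n => ((Finsupp.lsum R fun k =>
      (tensorAct κ r).flip (t k)) ∘ₗ sb.coords) n ∈ sb.tensorGrading E (i + d)) hn
      (fun k b hb => ?_) (fun x y hx hy => ?_) (by simp)
    · have := sb.tensorAct_mem_grading r (ht k) hb
      rw [show sb.deg k + d + (i - sb.deg k) = i + d by ring] at this
      simpa using this
    · rw [map_add]
      exact add_mem hx hy

theorem TensorHom.ofBasis_basis {d : ℤ} (t : κ → κ →₀ E.carrier)
    (ht : ∀ k, t k ∈ sb.tensorGrading E (sb.deg k + d)) (k : κ) :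
    (TensorHom.ofBasis sb r t ht).lin (e k) = t k := by
  ext j
  simp [ofBasis, r.map_one]

theorem TensorHom.ofBasis_mem {S : Submodule R E.carrier} (hS : ∀ b, ∀ x ∈ S, x * r.toFun b ∈ S)
    {d : ℤ} {t : κ → κ →₀ E.carrier} (ht : ∀ k, t k ∈ sb.tensorGrading E (sb.deg k + d))
    (htS : ∀ k, t k ∈ tensorSub κ S) (n : N.carrier) :
    (TensorHom.ofBasis sb r t ht).lin n ∈ tensorSub κ S := by
  refine sb.induction (p := fun n => (TensorHom.ofBasis sb r t ht).lin n ∈ tensorSub κ S) n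
    (fun k j a _ => ?_) (fun x y hx hy => ?_) (by simp)
  · rw [TensorHom.map_act, ofBasis_basis]
    exact tensorAct_mem hS (htS k) a
  · rw [map_add]
    exact add_mem hx hy

variable {sb l r}

/-- The difference of two graded maps. -/
def TensorHom.sub {d : ℤ} (f g : TensorHom sb r d) : TensorHom sb r d where
  lin := f.lin - g.lin
  map_act n b := by simp [f.map_act, g.map_act]
  map_mem hn := sub_mem (f.map_mem hn) (g.map_mem hn)

/-- The sum of two graded maps. -/
def TensorHom.add {d : ℤ} (f g : TensorHom sb r d) : TensorHom sb r d where
  lin := f.lin + g.lin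
  map_act n b := by simp [f.map_act, g.map_act]
  map_mem hn := add_mem (f.map_mem hn) (g.map_mem hn)

/-- An integer multiple of a graded map. -/
def TensorHom.zsmul {d : ℤ} (z : ℤ) (f : TensorHom sb r d) : TensorHom sb r d where
  lin := z • f.lin
  map_act n b := by simp [f.map_act]
  map_mem hn := zsmul_mem (f.map_mem hn) z

variable (l) in
/-- The boundary of a graded map of degree `-i + 1` in the Hom complex. -/
def TensorHom.boundary {i : ℤ} (h : TensorHom sb r (-i + 1)) : TensorHom sb r (-i) where
  lin := sb.tensorD l ∘ₗ h.lin + ksign i • (h.lin ∘ₗ N.dLin)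
  map_act n b := by
    refine homogeneous_induction N.spanning (p := fun n => (sb.tensorD l ∘ₗ h.lin + ksign i •
      (h.lin ∘ₗ N.dLin)) (N.smul n b) = tensorAct κ r b ((sb.tensorD l ∘ₗ h.lin + ksign i •
      (h.lin ∘ₗ N.dLin)) n)) n (fun j x hx => ?_) (fun x y hx hy => ?_)
    · simp only [LinearMap.add_apply, LinearMap.smul_apply, LinearMap.comp_apply,
        DGModule.dLin_apply, map_add, map_zsmul, N.leibniz _ _ hx, h.map_act,
        tensorD_act sb l r (h.map_mem hx), smul_add, smul_smul, ← ksign_add]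
      have : ksign (j + (-i + 1)) = -ksign (i + j) := by
        rw [ksign_congr (j := i + j - 1) ⟨1 - i, by ring⟩, ksign_sub_one]
      rw [this]
      module
    · rw [N.add_smul, map_add, map_add, map_add, hx, hy]
  map_mem {j n} hn := by
    refine add_mem ?_ (zsmul_mem ?_ _)
    · have := sb.tensorD_mem_grading l (h.map_mem hn)
      rwa [show j + (-i + 1) - 1 = j + -i by ring] at this
    · have := h.map_mem (N.d_mem hn)
      rwa [show j - 1 + (-i + 1) = j + -i by ring] at this

theorem TensorHom.boundary_apply {i : ℤ} (h : TensorHom sb r (-i + 1)) (n : N.carrier) :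
    (h.boundary l).lin n = sb.tensorD l (h.lin n) + ksign i • h.lin (N.d n) := rfl

theorem TensorHom.boundary_cocycle {i : ℤ} (h : TensorHom sb r (-i + 1)) (n : N.carrier) :
    sb.tensorD l ((h.boundary l).lin n) - ksign i • (h.boundary l).lin (N.d n) = 0 := by
  rw [boundary_apply, boundary_apply, map_add, tensorD_sq, N.d_sq, map_zero, map_zsmul]
  simp

variable (sb l r) in
/-- The vanishing of `Ext^i(N, N ⊗_B S/Z)`, expressed in terms of maps to `N ⊗_B E`. -/
def RelExtVanish (i : ℤ) (S Z : Submodule R E.carrier) : Prop :=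
  ∀ F : TensorHom sb r (-i), (∀ n, F.lin n ∈ tensorSub κ S) →
    (∀ n, sb.tensorD l (F.lin n) - ksign i • F.lin (N.d n) ∈ tensorSub κ Z) →
    ∃ h : TensorHom sb r (-i + 1), (∀ n, h.lin n ∈ tensorSub κ S) ∧
      ∀ n, F.lin n - (h.boundary l).lin n ∈ tensorSub κ Z

theorem RelExtVanish.refl (i : ℤ) (S : Submodule R E.carrier) : RelExtVanish sb l r i S S := by
  intro F hF _
  refine ⟨⟨0, by simp, by simp⟩, by simp, fun n => ?_⟩
  simpa [TensorHom.boundary_apply] using hF n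

theorem RelExtVanish.trans {i : ℤ} {S S' Z : Submodule R E.carrier} (hle : S' ≤ S)
    (h₁ : RelExtVanish sb l r i S S') (h₂ : RelExtVanish sb l r i S' Z) (hZ : Z ≤ S') :
    RelExtVanish sb l r i S Z := by
  have mono {X Y : Submodule R E.carrier} (h : X ≤ Y) : tensorSub κ X ≤ tensorSub κ Y :=
    fun t ht => (Finsupp.mem_submodule_iff _ _).2 fun k =>
      h ((Finsupp.mem_submodule_iff _ _).1 ht k)
  intro F hF hFZ
  obtain ⟨h, hS, hh⟩ := h₁ F hF fun n => mono hZ (hFZ n)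
  obtain ⟨h', hS', hh'⟩ := h₂ (F.sub (h.boundary l)) hh fun n => by
    have := hFZ n
    rw [← sub_zero (_ - _), ← h.boundary_cocycle n] at this
    convert this using 1
    simp only [TensorHom.sub, LinearMap.sub_apply, map_sub, smul_sub]
    abel
  refine ⟨h.add h', fun n => add_mem (hS n) (mono hle (hS' n)), fun n => ?_⟩
  convert hh' n using 1
  simp only [TensorHom.sub, TensorHom.add, TensorHom.boundary_apply, LinearMap.sub_apply,
    LinearMap.add_apply, map_add, smul_add]
  abel

end SemifreeBasisOn

end Tensor

end

noncomputable section

variable {R : Type} [CommRing R]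

variable {B E : DGAlgebra R} {N : DGModule R B} {κ : Type} {e : κ → N.carrier}

/-- Stability of a submodule of `E` under the left action of `B` through `l`, the right action of
`B` through `r`, and the differential. -/
structure IsStable (l r : DGAlgHom B E) (S : Submodule R E.carrier) : Prop where
  mul_left : ∀ b, ∀ x ∈ S, l.toFun b * x ∈ S
  mul_right : ∀ b, ∀ x ∈ S, x * r.toFun b ∈ S
  d_mem : ∀ x ∈ S, E.d x ∈ S

section TensorSub

variable {S : Submodule R E.carrier} {W : Type} [AddCommGroup W] [Module R W]

/-- The inclusion of the `k`-th coordinate. -/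
def subSingle (k : κ) : S →ₗ[R] tensorSub κ S :=
  (Finsupp.lsingle k ∘ₗ S.subtype).codRestrict _ fun x => (Finsupp.mem_submodule_iff _ _).2 fun j =>
    by
      classical
      simp only [LinearMap.comp_apply, Finsupp.lsingle_apply, Finsupp.single_apply,
        Submodule.subtype_apply]
      split_ifs
      · exact x.2
      · exact zero_mem S

@[simp] theorem subSingle_coe (k : κ) (x : S) :
    (subSingle k x : κ →₀ E.carrier) = Finsupp.single k (x : E.carrier) := rfl

theorem subSingle_induction {S' : κ → Submodule R E.carrier} {p : tensorSub κ S → Prop}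
    (t : tensorSub κ S) (ht : (t : κ →₀ E.carrier) ∈ Finsupp.submodule S')
    (single : ∀ k, ∀ x : S, (x : E.carrier) ∈ S' k → p (subSingle k x))
    (add : ∀ t u, p t → p u → p (t + u)) (zero : p 0) : p t := by
  have ht' : (t : κ →₀ E.carrier) ∈ Finsupp.submodule fun k => S ⊓ S' k :=
    (Finsupp.mem_submodule_iff _ _).2 fun k => ⟨(Finsupp.mem_submodule_iff _ _).1 t.2 k,
      (Finsupp.mem_submodule_iff _ _).1 ht k⟩
  have hle : ∀ u ∈ Finsupp.submodule (fun k => S ⊓ S' k), u ∈ tensorSub κ S := fun u hu =>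
    (Finsupp.mem_submodule_iff _ _).2 fun k => ((Finsupp.mem_submodule_iff _ _).1 hu k).1
  exact Finsupp.submodule_induction (p := fun t => ∀ h : t ∈ tensorSub κ S, p ⟨t, h⟩) ht'
    (fun k x hx _ => single k ⟨x, hx.1⟩ hx.2)
    (fun t htS u huS ht hu _ => add ⟨t, hle t htS⟩ ⟨u, hle u huS⟩ (ht _) (hu _))
    (fun _ => zero) t.2

theorem subSingle_induction' {p : tensorSub κ S → Prop} (t : tensorSub κ S)
    (single : ∀ k, ∀ x : S, p (subSingle k x))
    (add : ∀ t u, p t → p u → p (t + u)) (zero : p 0) : p t :=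
  subSingle_induction (S' := fun _ => ⊤) t ((Finsupp.mem_submodule_iff _ _).2 fun _ => trivial)
    (fun k x _ => single k x) add zero

/-- A family of linear maps on the coordinates defines a linear map on `tensorSub κ S`. -/
def subLift (f : κ → S →ₗ[R] W) : tensorSub κ S →ₗ[R] W :=
  Finsupp.lsum R f ∘ₗ
    { toFun := fun t => Finsupp.onFinset t.1.support
        (fun k => (⟨t.1 k, (Finsupp.mem_submodule_iff _ _).1 t.2 k⟩ : S)) fun k hk => by
          rw [Finsupp.mem_support_iff]
          exact fun h => hk (Subtype.ext h)
      map_add' := fun t u => by ext k; simp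
      map_smul' := fun c t => by ext k; simp }

@[simp] theorem subLift_single (f : κ → S →ₗ[R] W) (k : κ) (x : S) :
    subLift f (subSingle k x) = f k x := by
  rw [← Finsupp.lsum_single R f k x, subLift, LinearMap.comp_apply]
  congr 1
  ext j
  by_cases h : k = j
  · subst h; simp
  · simp [Finsupp.single_eq_of_ne' h]

namespace IsStable

variable {l r : DGAlgHom B E} (hS : IsStable l r S) (sb : SemifreeBasisOn N e)

/-- Left multiplication on a stable submodule. -/
def mulL (hS : IsStable l r S) (b : B.carrier) : S →ₗ[R] S :=
  (LinearMap.mulLeft R (l.toFun b)).restrict (hS.mul_left b)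

/-- Right multiplication on a stable submodule. -/
def mulR (hS : IsStable l r S) (b : B.carrier) : S →ₗ[R] S :=
  (LinearMap.mulRight R (r.toFun b)).restrict (hS.mul_right b)

/-- The differential of a stable submodule. -/
def dS (hS : IsStable l r S) : S →ₗ[R] S := E.dLin.restrict hS.d_mem

/-- The right action on `N ⊗_B S`. -/
def act (κ : Type) (hS : IsStable l r S) (b : B.carrier) : tensorSub κ S →ₗ[R] tensorSub κ S :=
  (tensorAct κ r b).restrict fun _ ht => tensorAct_mem hS.mul_right ht b

/-- The differential of `N ⊗_B S`. -/
def D (hS : IsStable l r S) (sb : SemifreeBasisOn N e) : tensorSub κ S →ₗ[R] tensorSub κ S :=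
  (sb.tensorD l).restrict fun _ ht => sb.tensorD_mem l hS.mul_left hS.d_mem ht

/-- The pairing `N × S → N ⊗_B S`. -/
def pair (hS : IsStable l r S) (sb : SemifreeBasisOn N e) (n : N.carrier) :
    S →ₗ[R] tensorSub κ S :=
  (sb.tensorPair l n).restrict fun _ hx => sb.tensorPair_mem l hS.mul_left n hx

@[simp] theorem mulL_coe (b : B.carrier) (x : S) : (hS.mulL b x : E.carrier) = l.toFun b * x := rfl

@[simp] theorem mulR_coe (b : B.carrier) (x : S) : (hS.mulR b x : E.carrier) = x * r.toFun b := rfl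

@[simp] theorem dS_coe (x : S) : (hS.dS x : E.carrier) = E.d x := rfl

@[simp] theorem act_coe (b : B.carrier) (t : tensorSub κ S) :
    (hS.act κ b t : κ →₀ E.carrier) = tensorAct κ r b t := rfl

@[simp] theorem D_coe (t : tensorSub κ S) :
    (hS.D sb t : κ →₀ E.carrier) = sb.tensorD l t := rfl

@[simp] theorem pair_coe (n : N.carrier) (x : S) :
    (hS.pair sb n x : κ →₀ E.carrier) = sb.tensorPair l n x := rfl

theorem act_single (b : B.carrier) (k : κ) (x : S) :
    hS.act κ b (subSingle k x) = subSingle k (hS.mulR b x) :=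
  Subtype.ext (tensorAct_single r b k x)

theorem D_single (k : κ) (x : S) : hS.D sb (subSingle k x) =
    hS.pair sb (N.d (e k)) x + ksign (sb.deg k) • subSingle k (hS.dS x) :=
  Subtype.ext (sb.tensorD_single l k x)

theorem pair_add (m n : N.carrier) (x : S) :
    hS.pair sb (m + n) x = hS.pair sb m x + hS.pair sb n x :=
  Subtype.ext (LinearMap.map_add₂ (sb.tensorPair l) m n x)

theorem pair_rsmul (c : R) (n : N.carrier) (x : S) :
    hS.pair sb (c • n) x = c • hS.pair sb n x :=
  Subtype.ext (LinearMap.map_smul₂ (sb.tensorPair l) c n x)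

theorem pair_zero (x : S) : hS.pair sb 0 x = 0 :=
  Subtype.ext (LinearMap.map_zero₂ (sb.tensorPair l) x)

theorem pair_smul (n : N.carrier) (b : B.carrier) (x : S) :
    hS.pair sb (N.smul n b) x = hS.pair sb n (hS.mulL b x) :=
  Subtype.ext (sb.tensorPair_smul l n b x)

theorem pair_basis (k : κ) (x : S) : hS.pair sb (e k) x = subSingle k x :=
  Subtype.ext (sb.tensorPair_basis l k x)

theorem pair_mulR (n : N.carrier) (b : B.carrier) (x : S) :
    hS.pair sb n (hS.mulR b x) = hS.act κ b (hS.pair sb n x) :=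
  Subtype.ext (sb.tensorPair_mul l r n x b)

theorem D_pair {i : ℤ} {n : N.carrier} (hn : n ∈ N.grading i) (x : S) :
    hS.D sb (hS.pair sb n x) = hS.pair sb (N.d n) x + ksign i • hS.pair sb n (hS.dS x) :=
  Subtype.ext (sb.tensorD_pair l hn x)

end IsStable

/-- A stable submodule `S` whose quotient by `Z` is a shift `B(-a)` as a DG bimodule: `c` is the
coordinate with respect to the generator `x₀`. -/
structure RankOneStep (l r : DGAlgHom B E) (S Z : Submodule R E.carrier) (a : ℤ) where
  stable : IsStable l r S
  c : S →ₗ[R] B.carrier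
  c_left : ∀ {j b}, b ∈ B.grading j → ∀ x, c (stable.mulL b x) = ksign (a * j) • (b * c x)
  c_right : ∀ b x, c (stable.mulR b x) = c x * b
  c_d : ∀ x, c (stable.dS x) = ksign a • B.d (c x)
  c_mem : ∀ {j} (x : S), (x : E.carrier) ∈ E.grading j → c x ∈ B.grading (j - a)
  c_eq_zero : ∀ x, c x = 0 ↔ (x : E.carrier) ∈ Z
  x₀ : S
  x₀_mem : (x₀ : E.carrier) ∈ E.grading a
  c_x₀ : c x₀ = 1

namespace RankOneStep

open SemifreeBasisOn

variable {l r : DGAlgHom B E} {Z : Submodule R E.carrier} {a : ℤ} (st : RankOneStep l r S Z a)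
  (sb : SemifreeBasisOn N e)

/-- The identification of `N ⊗_B S/Z` with a shift of `N`. -/
def toN (st : RankOneStep l r S Z a) (sb : SemifreeBasisOn N e) : tensorSub κ S →ₗ[R] N.carrier :=
  subLift fun k => ksign (a * sb.deg k) • (N.act (e k) ∘ₗ st.c)

theorem toN_single (k : κ) (x : S) :
    st.toN sb (subSingle k x) = ksign (a * sb.deg k) • N.smul (e k) (st.c x) := by
  simp only [toN, subLift_single]
  rfl

theorem toN_zsmul (z : ℤ) (t : tensorSub κ S) : st.toN sb (z • t) = z • st.toN sb t :=
  map_zsmul (st.toN sb).toAddMonoidHom z t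

theorem toN_sub (t u : tensorSub κ S) : st.toN sb (t - u) = st.toN sb t - st.toN sb u :=
  LinearMap.map_sub (st.toN sb) t u

theorem coords_toN (t : tensorSub κ S) (k : κ) : sb.coords (st.toN sb t) k =
    ksign (a * sb.deg k) • st.c ⟨t.1 k, (Finsupp.mem_submodule_iff _ _).1 t.2 k⟩ := by
  refine subSingle_induction' (p := fun t => sb.coords (st.toN sb t) k =
    ksign (a * sb.deg k) • st.c ⟨t.1 k, (Finsupp.mem_submodule_iff _ _).1 t.2 k⟩) t
    (fun j x => ?_) (fun t u ht hu => ?_) ?_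
  · rw [toN_single, map_zsmul, coords_smul_basis]
    by_cases h : j = k
    · subst h; simp
    · have : (⟨(subSingle j x).1 k, (Finsupp.mem_submodule_iff _ _).1 (subSingle j x).2 k⟩ : S) =
          0 := Subtype.ext (Finsupp.single_eq_of_ne' h)
      rw [this]
      simp [Finsupp.single_eq_of_ne' h]
  · rw [map_add, map_add, Finsupp.add_apply, ht, hu, ← smul_add, ← map_add]
    rfl
  · have : (⟨(0 : tensorSub κ S).1 k, (Finsupp.mem_submodule_iff _ _).1 (0 : tensorSub κ S).2 k⟩ :
        S) = 0 := rfl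
    rw [this]
    simp

theorem toN_pair {m : ℤ} {n : N.carrier} (hn : n ∈ N.grading m) (x : S) :
    st.toN sb (st.stable.pair sb n x) = ksign (a * m) • N.smul n (st.c x) := by
  refine sb.induction_of_mem (p := fun n => st.toN sb (st.stable.pair sb n x) =
    ksign (a * m) • N.smul n (st.c x)) hn (fun k b hb => ?_) (fun y z hy hz => ?_) ?_
  · rw [st.stable.pair_smul, st.stable.pair_basis, toN_single, st.c_left hb, N.smul_zsmul,
      smul_smul, ← ksign_add, N.smul_mul]
    congr 2
    ring
  · rw [st.stable.pair_add, map_add, hy, hz, N.add_smul, smul_add]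
  · have : N.smul 0 (st.c x) = 0 := LinearMap.map_zero₂ N.act _
    rw [st.stable.pair_zero, map_zero, this, smul_zero]

theorem toN_D (t : tensorSub κ S) :
    st.toN sb (st.stable.D sb t) = ksign a • N.d (st.toN sb t) := by
  refine subSingle_induction' (p := fun t => st.toN sb (st.stable.D sb t) =
    ksign a • N.d (st.toN sb t)) t (fun k x => ?_) (fun t u ht hu => ?_) ?_
  · rw [st.stable.D_single, map_add, toN_zsmul, st.toN_pair sb (N.d_mem (sb.homog k)), toN_single,
      toN_single, st.c_d, N.smul_zsmul, N.d_zsmul, N.leibniz _ _ (sb.homog k)]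
    simp only [smul_add, smul_smul, ← ksign_add]
    rw [ksign_congr (i := a * (sb.deg k - 1)) (j := a + a * sb.deg k) ⟨-a, by ring⟩]
    congr 3
    ring
  · rw [map_add, map_add, map_add, ht, hu, N.d_add, smul_add]
  · have : N.d 0 = 0 := map_zero N.dLin
    simp [this]

theorem toN_act (b : B.carrier) (t : tensorSub κ S) :
    st.toN sb (st.stable.act κ b t) = N.smul (st.toN sb t) b := by
  refine subSingle_induction' (p := fun t => st.toN sb (st.stable.act κ b t) =
    N.smul (st.toN sb t) b) t (fun k x => ?_) (fun t u ht hu => ?_) ?_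
  · rw [st.stable.act_single, toN_single, toN_single, st.c_right, N.zsmul_smul, N.smul_mul]
  · rw [map_add, map_add, map_add, ht, hu, N.add_smul]
  · have : N.smul 0 b = 0 := LinearMap.map_zero₂ N.act b
    simp [this]

theorem toN_mem {i : ℤ} {t : tensorSub κ S} (ht : t.1 ∈ sb.tensorGrading E i) :
    st.toN sb t ∈ N.grading (i - a) := by
  refine subSingle_induction (p := fun t => st.toN sb t ∈ N.grading (i - a)) t ht
    (fun k x hx => ?_) (fun t u ht hu => ?_) (by simp)
  · rw [toN_single]
    have := N.smul_mem (sb.homog k) (st.c_mem x hx)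
    rw [show sb.deg k + (i - sb.deg k - a) = i - a by ring] at this
    exact zsmul_mem this _
  · rw [map_add]
    exact add_mem ht hu

theorem mem_of_toN_eq_zero {t : tensorSub κ S} (h : st.toN sb t = 0) : t.1 ∈ tensorSub κ Z := by
  rw [Finsupp.mem_submodule_iff]
  intro k
  have hk := st.coords_toN sb t k
  rw [h, map_zero, Finsupp.zero_apply] at hk
  refine (st.c_eq_zero ⟨t.1 k, (Finsupp.mem_submodule_iff _ _).1 t.2 k⟩).1 ?_
  rw [← one_smul ℤ (st.c _), ← ksign_mul_self (a * sb.deg k), mul_smul, ← hk, smul_zero]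

theorem toN_eq_zero_of_mem {t : tensorSub κ S} (h : t.1 ∈ tensorSub κ Z) : st.toN sb t = 0 := by
  refine sb.coords_injective fun k => ?_
  rw [coords_toN, (st.c_eq_zero _).2 ((Finsupp.mem_submodule_iff _ _).1 h k)]
  simp

theorem exists_lift {j : ℤ} {n : N.carrier} (hn : n ∈ N.grading j) :
    ∃ t : tensorSub κ S, t.1 ∈ sb.tensorGrading E (j + a) ∧ st.toN sb t = n := by
  refine sb.induction_of_mem (p := fun n => ∃ t : tensorSub κ S,
    t.1 ∈ sb.tensorGrading E (j + a) ∧ st.toN sb t = n) hn (fun k b hb => ?_) ?_ ?_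
  · refine ⟨ksign (a * sb.deg k) • subSingle k (st.stable.mulR b st.x₀),
      zsmul_mem (sb.single_mem_tensorGrading ?_) _, ?_⟩
    · have := E.mul_mem st.x₀_mem (r.map_mem hb)
      rwa [show a + (j - sb.deg k) = j + a - sb.deg k by ring] at this
    · rw [toN_zsmul, toN_single, smul_smul, ksign_mul_self, one_smul, st.c_right, st.c_x₀, one_mul]
  · rintro _ _ ⟨t, ht, rfl⟩ ⟨u, hu, rfl⟩
    exact ⟨t + u, add_mem ht hu, map_add _ _ _⟩
  · exact ⟨0, zero_mem _, map_zero _⟩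

theorem relExtVanish (st : RankOneStep l r S Z a) (sb : SemifreeBasisOn N e) {i : ℤ}
    (hext : ExtVanish (i + a) N N) : RelExtVanish sb l r i S Z := by
  intro F hF hFZ
  have hS := st.stable
  let F' : N.carrier →ₗ[R] tensorSub κ S := F.lin.codRestrict _ hF
  have hact (n b) : F' (N.smul n b) = hS.act κ b (F' n) := Subtype.ext (F.map_act n b)
  let f : GradedHom N N (-(i + a)) :=
    { toFun := fun n => st.toN sb (F' n)
      map_add := fun x y => by rw [map_add, map_add]
      map_rsmul := fun c x => by rw [map_smul, map_smul]
      map_smul := fun x b => by rw [hact, toN_act]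
      map_mem := fun {j x} hx => by
        have := st.toN_mem sb (t := F' x) (F.map_mem hx)
        rwa [show j + -i - a = j + -(i + a) by ring] at this }
  have hf : IsExtCocycle (i + a) f := by
    intro x
    have := st.toN_eq_zero_of_mem sb (t := hS.D sb (F' x) - ksign i • F' (N.d x)) (hFZ x)
    rw [toN_sub, toN_zsmul, toN_D, sub_eq_zero] at this
    change N.d (st.toN sb (F' x)) = ksign (i + a) • st.toN sb (F' (N.d x))
    rw [add_comm, ksign_add, mul_smul, ← this, smul_smul, ksign_mul_self, one_smul]
  obtain ⟨h, hh⟩ := hext f hf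
  choose t ht htn using fun k => st.exists_lift sb (h.map_mem (sb.homog k))
  have ht' (k) : (t k).1 ∈ sb.tensorGrading E (sb.deg k + (-i + 1)) := by
    have := ht k
    rwa [show sb.deg k + (-(i + a) + 1) + a = sb.deg k + (-i + 1) by ring] at this
  let H : TensorHom sb r (-i + 1) := TensorHom.ofBasis sb r (fun k => (t k).1) ht'
  have hHS (n) : H.lin n ∈ tensorSub κ S :=
    TensorHom.ofBasis_mem sb r hS.mul_right ht' (fun k => (t k).2) n
  let H' : N.carrier →ₗ[R] tensorSub κ S := H.lin.codRestrict _ hHS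
  have hH : st.toN sb ∘ₗ H' = h.lin := by
    refine sb.eq_of_eq_on_basis (N.act.flip) (fun n b => ?_) (fun n b => h.map_smul n b)
      fun k => ?_
    · have : H' (N.smul n b) = hS.act κ b (H' n) := Subtype.ext (H.map_act n b)
      rw [LinearMap.comp_apply, this, toN_act]
      rfl
    · have : H' (e k) = t k := Subtype.ext (TensorHom.ofBasis_basis sb r _ ht' k)
      rw [LinearMap.comp_apply, this, htn]
      rfl
  have hH' (n) : st.toN sb (H' n) = h.toFun n := LinearMap.congr_fun hH n
  refine ⟨H.zsmul (ksign a), fun n => zsmul_mem (hHS n) _, fun n => ?_⟩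
  refine st.mem_of_toN_eq_zero sb (t := F' n - (hS.D sb (ksign a • H' n) +
    ksign i • ksign a • H' (N.d n))) ?_
  rw [toN_sub, map_add, toN_zsmul, toN_zsmul, toN_D, toN_zsmul, hH', hH', N.d_zsmul, smul_smul,
    smul_smul, ksign_mul_self, one_smul, ← ksign_add, sub_eq_zero]
  exact hh n

end RankOneStep

end TensorSub

end

noncomputable section

variable {R : Type} [CommRing R]

/-- A submodule generated by homogeneous elements. -/
def IsGradedSub {M : Type} [AddCommGroup M] [Module R M] (G : ℤ → Submodule R M)
    (S : Submodule R M) : Prop :=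
  ∀ x ∈ S, x ∈ Submodule.span R ((S : Set M) ∩ ⋃ i, (G i : Set M))

section GradedSub

variable {M : Type} [AddCommGroup M] [Module R M] {G : ℤ → Submodule R M} {S : Submodule R M}

theorem IsGradedSub.induction (hS : IsGradedSub G S) {p : M → Prop} {x : M} (hx : x ∈ S)
    (hom : ∀ i, ∀ x ∈ S, x ∈ G i → p x) (add : ∀ x ∈ S, ∀ y ∈ S, p x → p y → p (x + y)) :
    p x := by
  suffices h : x ∈ S ∧ p x from h.2
  refine Submodule.closure_induction (R := R) (p := fun x _ => x ∈ S ∧ p x)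
    ⟨zero_mem _, hom 0 0 (zero_mem _) (zero_mem _)⟩
    (fun x y _ _ hx hy => ⟨add_mem hx.1 hy.1, add x hx.1 y hy.1 hx.2 hy.2⟩)
    (fun c x hx => ?_) (hS x hx)
  obtain ⟨hxS, hx⟩ := hx
  obtain ⟨i, hi⟩ := Set.mem_iUnion.1 hx
  exact ⟨S.smul_mem c hxS, hom i _ (S.smul_mem c hxS) ((G i).smul_mem c hi)⟩

theorem IsGradedSub.homComp_mem_of_mem (hS : IsGradedSub G S)
    (hi : ∀ i, Disjoint (G i) (⨆ j ≠ i, G j)) (hs : ⨆ i, G i = ⊤) (i : ℤ) {x : M} (hx : x ∈ S) :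
    homComp hi hs i x ∈ S := by
  refine hS.induction (p := fun x => homComp hi hs i x ∈ S) hx (fun j x hx hj => ?_)
    fun x _ y _ hx hy => ?_
  · rcases eq_or_ne j i with rfl | h
    · rwa [homComp_of_mem hi hs hj]
    · rw [homComp_of_ne hi hs h hj]
      exact zero_mem S
  · rw [map_add]
    exact add_mem hx hy

end GradedSub

/-- The quotient of a DG module by a DG submodule. -/
def DGModule.quot {A : DGAlgebra R} (M : DGModule R A) (Z : Submodule R M.carrier)
    (hact : ∀ a, ∀ z ∈ Z, M.smul z a ∈ Z) (hd : ∀ z ∈ Z, M.d z ∈ Z)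
    (hgr : IsGradedSub M.grading Z) : DGModule R A where
  carrier := M.carrier ⧸ Z
  grading i := (M.grading i).map Z.mkQ
  indep := disjoint_grading_of_components
    (fun i => Z.mapQ Z (M.comp i) fun _ hz => hgr.homComp_mem_of_mem M.indep M.spanning i hz)
    (by
      rintro i _ ⟨x, hx, rfl⟩
      rw [Submodule.mkQ_apply, Submodule.mapQ_apply, homComp_of_mem _ _ hx])
    (by
      rintro i j h _ ⟨x, hx, rfl⟩
      rw [Submodule.mkQ_apply, Submodule.mapQ_apply, homComp_of_ne _ _ h hx,
        Submodule.Quotient.mk_zero])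
  spanning := by
    rw [← Submodule.map_iSup, M.spanning, Submodule.map_top, Submodule.range_mkQ]
  smul x a := Z.mapQ Z (M.act.flip a) (hact a) x
  smul_add x a b := by
    induction x using Submodule.Quotient.induction_on with
    | H x => exact congrArg Z.mkQ (M.smul_add x a b)
  add_smul x y a := map_add _ x y
  smul_rsmul c x a := by
    induction x using Submodule.Quotient.induction_on with
    | H x => exact congrArg Z.mkQ (M.smul_rsmul c x a)
  rsmul_smul c x a := map_smul _ c x
  smul_one x := by
    induction x using Submodule.Quotient.induction_on with
    | H x => exact congrArg Z.mkQ (M.smul_one x)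
  smul_mul x a b := by
    induction x using Submodule.Quotient.induction_on with
    | H x => exact congrArg Z.mkQ (M.smul_mul x a b)
  smul_mem := by
    rintro i j _ a ⟨x, hx, rfl⟩ ha
    exact ⟨_, M.smul_mem hx ha, rfl⟩
  d := Z.mapQ Z M.dLin hd
  d_add := map_add _
  d_rsmul := map_smul _
  d_mem := by
    rintro i _ ⟨x, hx, rfl⟩
    exact ⟨_, M.d_mem hx, rfl⟩
  d_sq x := by
    induction x using Submodule.Quotient.induction_on with
    | H x => exact congrArg Z.mkQ (M.d_sq x)
  leibniz := by
    rintro i _ a ⟨x, hx, rfl⟩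
    refine (congrArg Z.mkQ (M.leibniz x a hx)).trans ?_
    rw [map_add, map_zsmul]
    rfl

variable {B E : DGAlgebra R} {N : DGModule R B} {κ : Type} {e : κ → N.carrier}
  {l r : DGAlgHom B E} {S Z : Submodule R E.carrier}

theorem SemifreeBasisOn.isGradedSub_tensorSub (sb : SemifreeBasisOn N e)
    (hS : IsGradedSub E.grading S) : IsGradedSub (sb.tensorGrading E) (tensorSub κ S) := by
  intro t ht
  set P := Submodule.span R
    ((tensorSub κ S : Set (κ →₀ E.carrier)) ∩ ⋃ i, (sb.tensorGrading E i : Set _)) with hP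
  clear_value P
  refine Finsupp.submodule_induction (p := fun t => t ∈ P) ht
    (fun k x hx => ?_) (fun _ _ _ _ h h' => add_mem h h') (zero_mem _)
  refine hS.induction (p := fun x => Finsupp.single k x ∈ P) hx (fun i x hx hi => ?_)
    fun x _ y _ hx hy => ?_
  · rw [hP]
    refine Submodule.subset_span ⟨(subSingle k (⟨x, hx⟩ : S)).2,
      Set.mem_iUnion.2 ⟨i + sb.deg k, sb.single_mem_tensorGrading ?_⟩⟩
    rwa [add_sub_cancel_right]
  · rw [Finsupp.single_add]
    exact add_mem hx hy

namespace IsStable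

variable (hS : IsStable l r S) (sb : SemifreeBasisOn N e)

theorem D_D (t : tensorSub κ S) : hS.D sb (hS.D sb t) = 0 := Subtype.ext (sb.tensorD_sq l t.1)

theorem D_act {i : ℤ} {t : tensorSub κ S} (ht : t.1 ∈ sb.tensorGrading E i) (b : B.carrier) :
    hS.D sb (hS.act κ b t) = hS.act κ b (hS.D sb t) + ksign i • hS.act κ (B.d b) t :=
  Subtype.ext (sb.tensorD_act l r ht b)

theorem act_add (b c : B.carrier) (t : tensorSub κ S) :
    hS.act κ (b + c) t = hS.act κ b t + hS.act κ c t :=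
  Subtype.ext (LinearMap.map_add₂ (tensorAct κ r) b c t.1)

theorem act_rsmul (c : R) (b : B.carrier) (t : tensorSub κ S) :
    hS.act κ (c • b) t = c • hS.act κ b t :=
  Subtype.ext (LinearMap.map_smul₂ (tensorAct κ r) c b t.1)

end IsStable

/-- The DG module `N ⊗_B S`. -/
def tensorModule (sb : SemifreeBasisOn N e) (hS : IsStable l r S)
    (hgr : IsGradedSub E.grading S) : DGModule R B where
  carrier := tensorSub κ S
  grading i := (sb.tensorGrading E i).comap (tensorSub κ S).subtype
  indep i := by
    have hd := disjoint_grading_of_components (G := sb.tensorGrading E) (sb.tensorComp E)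
      (fun i t ht => Finsupp.ext fun k => by
        rw [sb.tensorComp_apply, homComp_of_mem _ _ (sb.mem_tensorGrading.1 ht k)])
      (fun i j h t ht => Finsupp.ext fun k => by
        rw [sb.tensorComp_apply, homComp_of_ne _ _ (by simpa using h)
          (sb.mem_tensorGrading.1 ht k), Finsupp.zero_apply]) i
    rw [Submodule.disjoint_def] at hd ⊢
    intro x hx hx'
    refine Subtype.ext (hd x.1 hx ?_)
    have hle : (⨆ j ≠ i, (sb.tensorGrading E j).comap (tensorSub κ S).subtype) ≤
        (⨆ j ≠ i, sb.tensorGrading E j).comap (tensorSub κ S).subtype :=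
      iSup₂_le fun j hj => Submodule.comap_mono (le_iSup₂_of_le j hj le_rfl)
    exact hle hx'
  spanning := by
    refine (Submodule.eq_top_iff').2 fun t => ?_
    obtain ⟨t, ht⟩ := t
    refine (sb.isGradedSub_tensorSub hgr).induction (p := fun t => ∀ ht : t ∈ tensorSub κ S,
      (⟨t, ht⟩ : tensorSub κ S) ∈ ⨆ i, (sb.tensorGrading E i).comap (tensorSub κ S).subtype) ht
      (fun i t _ hi ht => Submodule.mem_iSup_of_mem i hi)
      (fun t ht u hu ht' hu' _ => add_mem (ht' ht) (hu' hu)) ht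
  smul t b := hS.act κ b t
  smul_add t b c := hS.act_add b c t
  add_smul t u b := by exact (hS.act κ b).map_add t u
  smul_rsmul c t b := hS.act_rsmul c b t
  rsmul_smul c t b := by exact (hS.act κ b).map_smul c t
  smul_one t := Subtype.ext (Finsupp.ext fun k => by simp [r.map_one])
  smul_mul t b c := Subtype.ext (tensorAct_tensorAct r b c t.1)
  smul_mem ht hb := sb.tensorAct_mem_grading r ht hb
  d := hS.D sb
  d_add t u := by exact (hS.D sb).map_add t u
  d_rsmul c t := by exact (hS.D sb).map_smul c t
  d_mem ht := sb.tensorD_mem_grading l ht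
  d_sq := hS.D_D sb
  leibniz t b ht := by exact hS.D_act sb (t := t) ht b

end

noncomputable section

variable {R : Type} [CommRing R]

/-- The identity of a DG module. -/
def DGHom.id {A : DGAlgebra R} (M : DGModule R A) : DGHom M M where
  toFun x := x
  map_add _ _ := rfl
  map_rsmul _ _ := rfl
  map_smul _ _ := rfl
  map_mem h := h
  comm_d _ := rfl

/-- The composition of homomorphisms of DG modules. -/
def DGHom.comp {A : DGAlgebra R} {M N W : DGModule R A} (g : DGHom N W) (f : DGHom M N) :
    DGHom M W where
  toFun x := g.toFun (f.toFun x)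
  map_add x y := by rw [f.map_add, g.map_add]
  map_rsmul c x := by rw [f.map_rsmul, g.map_rsmul]
  map_smul x a := by rw [f.map_smul, g.map_smul]
  map_mem h := g.map_mem (f.map_mem h)
  comm_d x := by rw [f.comm_d, g.comm_d]

/-- The homomorphism from a quotient induced by a homomorphism vanishing on the submodule. -/
def DGModule.quotLift {A : DGAlgebra R} {M W : DGModule R A} {Z : Submodule R M.carrier}
    {hact : ∀ a, ∀ z ∈ Z, M.smul z a ∈ Z} {hd : ∀ z ∈ Z, M.d z ∈ Z}
    {hgr : IsGradedSub M.grading Z} (f : DGHom M W) (hf : ∀ z ∈ Z, f.toFun z = 0) :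
    DGHom (M.quot Z hact hd hgr) W where
  toFun := Z.liftQ f.lin hf
  map_add := map_add _
  map_rsmul := map_smul _
  map_smul x a := by
    induction x using Submodule.Quotient.induction_on with
    | H x => exact f.map_smul x a
  map_mem := by
    rintro i _ ⟨x, hx, rfl⟩
    exact f.map_mem hx
  comm_d x := by
    induction x using Submodule.Quotient.induction_on with
    | H x => exact f.comm_d x

variable {A B E : DGAlgebra R} {φ : DGAlgHom A B} {he : EnvelopingAlg φ E}
  {N W : DGModule R B} {κ : Type} {e : κ → N.carrier}
  {S Z : Submodule R E.carrier}

namespace TensorPairing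

variable (γ : TensorPairing φ he S Z N W) (hS : IsStable he.l he.r S) (sb : SemifreeBasisOn N e)

/-- A pairing as a bilinear map. -/
def lin : N.carrier →ₗ[R] S →ₗ[R] W.carrier :=
  LinearMap.mk₂ R (fun n x => γ.pair n x) (fun m n x => γ.add_left m n x x.2)
    (fun c n x => γ.rsmul_left c n x x.2) (fun n x y => γ.add_right n x y x.2 y.2)
    (fun c n x => γ.rsmul_right c n x x.2)

theorem lin_apply (n : N.carrier) (x : S) : γ.lin n x = γ.pair n x := rfl

/-- The map out of `N ⊗_B S` induced by a pairing. -/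
def lift (_ : SemifreeBasisOn N e) : tensorSub κ S →ₗ[R] W.carrier :=
  subLift fun k => γ.lin (e k)

theorem lift_single (k : κ) (x : S) : γ.lift sb (subSingle k x) = γ.lin (e k) x :=
  subLift_single _ k x

theorem lift_zsmul (z : ℤ) (t : tensorSub κ S) : γ.lift sb (z • t) = z • γ.lift sb t :=
  map_zsmul (γ.lift sb).toAddMonoidHom z t

theorem lift_pair (n : N.carrier) (x : S) : γ.lift sb (hS.pair sb n x) = γ.lin n x := by
  refine sb.induction (p := fun n => γ.lift sb (hS.pair sb n x) = γ.lin n x) n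
    (fun k j b _ => ?_) (fun m n hm hn => ?_) ?_
  · rw [hS.pair_smul, hS.pair_basis, lift_single]
    exact (γ.balanced (e k) b x x.2).symm
  · rw [hS.pair_add, map_add, hm, hn, LinearMap.map_add₂]
  · rw [hS.pair_zero, map_zero, LinearMap.map_zero₂]

theorem lift_act (b : B.carrier) (t : tensorSub κ S) :
    γ.lift sb (hS.act κ b t) = W.smul (γ.lift sb t) b := by
  refine subSingle_induction' (p := fun t => γ.lift sb (hS.act κ b t) = W.smul (γ.lift sb t) b) t
    (fun k x => ?_) (fun t u ht hu => ?_) ?_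
  · rw [hS.act_single, lift_single, lift_single]
    exact γ.act_right (e k) b x x.2
  · rw [map_add, map_add, map_add, ht, hu, W.add_smul]
  · have : W.smul 0 b = 0 := LinearMap.map_zero₂ W.act b
    simp [this]

theorem lift_D (t : tensorSub κ S) : γ.lift sb (hS.D sb t) = W.d (γ.lift sb t) := by
  refine subSingle_induction' (p := fun t => γ.lift sb (hS.D sb t) = W.d (γ.lift sb t)) t
    (fun k x => ?_) (fun t u ht hu => ?_) ?_
  · rw [hS.D_single, map_add, lift_zsmul, lift_pair, lift_single, lift_single]
    exact (γ.chain (e k) x (sb.homog k) x.2).symm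
  · rw [map_add, map_add, map_add, ht, hu, W.d_add]
  · have : W.d 0 = 0 := map_zero W.dLin
    simp [this]

theorem lift_mem {i : ℤ} {t : tensorSub κ S} (ht : t.1 ∈ sb.tensorGrading E i) :
    γ.lift sb t ∈ W.grading i := by
  refine subSingle_induction (p := fun t => γ.lift sb t ∈ W.grading i) t ht
    (fun k x hx => ?_) (fun t u ht hu => ?_) (by simp)
  · have := γ.grade (e k) x (sb.homog k) x.2 hx
    rwa [add_sub_cancel, ← lin_apply, ← lift_single] at this
  · rw [map_add]
    exact add_mem ht hu

theorem lift_eq_zero {t : tensorSub κ S} (ht : t.1 ∈ tensorSub κ Z) : γ.lift sb t = 0 := by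
  refine subSingle_induction (p := fun t => γ.lift sb t = 0) t ht
    (fun k x hx => ?_) (fun t u ht hu => ?_) (by simp)
  · rw [lift_single]
    exact γ.kill (e k) x hx
  · rw [map_add, ht, hu, add_zero]

/-- The homomorphism of DG modules out of `N ⊗_B S` induced by a pairing. -/
def liftHom (hgr : IsGradedSub E.grading S) : DGHom (tensorModule sb hS hgr) W where
  toFun := γ.lift sb
  map_add t u := by exact (γ.lift sb).map_add t u
  map_rsmul c t := by exact (γ.lift sb).map_smul c t
  map_smul t b := γ.lift_act hS sb b t
  map_mem {_ t} ht := by exact γ.lift_mem sb (t := t) ht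
  comm_d := γ.lift_D hS sb

end TensorPairing

theorem tensorSub_mono {X Y : Submodule R E.carrier} (h : X ≤ Y) :
    tensorSub κ X ≤ tensorSub κ Y := fun _ ht =>
  (Finsupp.mem_submodule_iff _ _).2 fun k => h ((Finsupp.mem_submodule_iff _ _).1 ht k)

section Quotient

variable (sb : SemifreeBasisOn N e) (hS : IsStable he.l he.r S) (hgS : IsGradedSub E.grading S)
  (hZ : IsStable he.l he.r Z) (hgZ : IsGradedSub E.grading Z) (hZS : Z ≤ S)

/-- The kernel of the quotient map `N ⊗_B S → N ⊗_B S/Z`. -/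
def tensorKer (sb : SemifreeBasisOn N e) (hS : IsStable he.l he.r S)
    (hgS : IsGradedSub E.grading S) (Z : Submodule R E.carrier) :
    Submodule R (tensorModule sb hS hgS).carrier :=
  (tensorSub κ Z).comap (tensorSub κ S).subtype

theorem isGradedSub_tensorKer (hgZ : IsGradedSub E.grading Z) (hZS : Z ≤ S) :
    IsGradedSub (tensorModule sb hS hgS).grading (tensorKer sb hS hgS Z) := by
  rintro ⟨t, htS⟩ ht
  set P := Submodule.span R ((tensorKer sb hS hgS Z : Set (tensorModule sb hS hgS).carrier) ∩
    ⋃ i, ((tensorModule sb hS hgS).grading i : Set _)) with hP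
  refine (sb.isGradedSub_tensorSub hgZ).induction
    (p := fun t => ∀ ht : t ∈ tensorSub κ S, (⟨t, ht⟩ : tensorSub κ S) ∈ P) ht
    (fun i t ht hi _ => Submodule.subset_span ⟨ht, Set.mem_iUnion.2 ⟨i, hi⟩⟩)
    (fun t ht u hu ht' hu' _ =>
      add_mem (ht' (tensorSub_mono hZS ht)) (hu' (tensorSub_mono hZS hu))) htS

/-- The DG module `N ⊗_B S/Z`. -/
def tensorQuot (sb : SemifreeBasisOn N e) (hS : IsStable he.l he.r S)
    (hgS : IsGradedSub E.grading S) (hZ : IsStable he.l he.r Z) (hgZ : IsGradedSub E.grading Z)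
    (hZS : Z ≤ S) : DGModule R B :=
  (tensorModule sb hS hgS).quot (tensorKer sb hS hgS Z)
    (fun b _ ht => tensorAct_mem hZ.mul_right ht b)
    (fun _ ht => sb.tensorD_mem he.l hZ.mul_left hZ.d_mem ht)
    (isGradedSub_tensorKer sb hS hgS hgZ hZS)

/-- The quotient map `N ⊗_B S → N ⊗_B S/Z`. -/
def tensorQuotMk : tensorSub κ S →ₗ[R] (tensorQuot sb hS hgS hZ hgZ hZS).carrier :=
  (tensorKer sb hS hgS Z).mkQ

theorem tensorQuotMk_eq_zero {t : tensorSub κ S} :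
    tensorQuotMk sb hS hgS hZ hgZ hZS t = 0 ↔ t.1 ∈ tensorSub κ Z :=
  Submodule.Quotient.mk_eq_zero (tensorKer sb hS hgS Z)

theorem tensorQuotMk_act (b : B.carrier) (t : tensorSub κ S) :
    tensorQuotMk sb hS hgS hZ hgZ hZS (hS.act κ b t) =
      (tensorQuot sb hS hgS hZ hgZ hZS).smul (tensorQuotMk sb hS hgS hZ hgZ hZS t) b := rfl

theorem tensorQuotMk_D (t : tensorSub κ S) :
    tensorQuotMk sb hS hgS hZ hgZ hZS (hS.D sb t) =
      (tensorQuot sb hS hgS hZ hgZ hZS).d (tensorQuotMk sb hS hgS hZ hgZ hZS t) := rfl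

theorem tensorQuotMk_zsmul (z : ℤ) (t : tensorSub κ S) :
    tensorQuotMk sb hS hgS hZ hgZ hZS (z • t) = z • tensorQuotMk sb hS hgS hZ hgZ hZS t :=
  map_zsmul (tensorQuotMk sb hS hgS hZ hgZ hZS).toAddMonoidHom z t

theorem tensorQuotMk_sub (t u : tensorSub κ S) :
    tensorQuotMk sb hS hgS hZ hgZ hZS (t - u) =
      tensorQuotMk sb hS hgS hZ hgZ hZS t - tensorQuotMk sb hS hgS hZ hgZ hZS u :=
  (tensorQuotMk sb hS hgS hZ hgZ hZS).map_sub t u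

open Classical in
/-- The canonical pairing `N × S → N ⊗_B S/Z`. -/
def tensorQuotPairing :
    TensorPairing φ he S Z N (tensorQuot sb hS hgS hZ hgZ hZS) where
  pair n x := if h : x ∈ S then tensorQuotMk sb hS hgS hZ hgZ hZS (hS.pair sb n ⟨x, h⟩) else 0
  add_left m n x hx := by
    replace hx : x ∈ S := hx
    rw [dif_pos hx, dif_pos hx, dif_pos hx, hS.pair_add, map_add]
  add_right n x y hx hy := by
    replace hx : x ∈ S := hx
    replace hy : y ∈ S := hy
    rw [dif_pos hx, dif_pos hy, dif_pos (add_mem hx hy), ← map_add, ← map_add]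
    rfl
  rsmul_left c n x hx := by
    replace hx : x ∈ S := hx
    rw [dif_pos hx, dif_pos hx, hS.pair_rsmul, map_smul]
  rsmul_right c n x hx := by
    replace hx : x ∈ S := hx
    rw [dif_pos hx, dif_pos (S.smul_mem c hx), ← map_smul, ← map_smul]
    rfl
  balanced n b x hx := by
    replace hx : x ∈ S := hx
    rw [dif_pos hx, dif_pos (hS.mul_left b x hx), hS.pair_smul]
    rfl
  act_right n b x hx := by
    replace hx : x ∈ S := hx
    rw [dif_pos hx, dif_pos (hS.mul_right b x hx), ← tensorQuotMk_act, ← hS.pair_mulR]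
    rfl
  grade n x hn hx hj := by
    replace hx : x ∈ S := hx
    rw [dif_pos hx]
    exact ⟨_, sb.tensorPair_mem_grading he.l hn hj, rfl⟩
  chain n x hn hx := by
    replace hx : x ∈ S := hx
    rw [dif_pos hx, dif_pos hx, dif_pos (hS.d_mem x hx), ← tensorQuotMk_D, hS.D_pair sb hn,
      map_add, tensorQuotMk_zsmul]
    rfl
  kill n x hx := by
    rw [dif_pos (hZS hx), tensorQuotMk_eq_zero]
    exact sb.tensorPair_mem he.l hZ.mul_left n hx

theorem tensorQuotPairing_pair (n : N.carrier) (x : S) :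
    (tensorQuotPairing sb hS hgS hZ hgZ hZS).pair n x =
      tensorQuotMk sb hS hgS hZ hgZ hZS (hS.pair sb n x) := dif_pos x.2

/-- The homomorphism out of `N ⊗_B S/Z` induced by a pairing. -/
def TensorPairing.liftQuot (γ : TensorPairing φ he S Z N W) :
    DGHom (tensorQuot sb hS hgS hZ hgZ hZS) W :=
  DGModule.quotLift (γ.liftHom hS sb hgS) fun _ hz => γ.lift_eq_zero sb hz

theorem TensorPairing.liftQuot_mk (γ : TensorPairing φ he S Z N W) (t : tensorSub κ S) :
    (γ.liftQuot sb hS hgS hZ hgZ hZS).toFun (tensorQuotMk sb hS hgS hZ hgZ hZS t) =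
      γ.lift sb t := rfl

theorem IsTensorSubquot.extVanish (sb : SemifreeBasisOn N e) (hS : IsStable he.l he.r S)
    (hgS : IsGradedSub E.grading S) (hZ : IsStable he.l he.r Z) (hgZ : IsGradedSub E.grading Z)
    (hZS : Z ≤ S) {P : DGModule R B} (hP : IsTensorSubquot φ he S Z N P)
    {i : ℤ} (hrel : sb.RelExtVanish he.l he.r i S Z) : ExtVanish i N P := by
  intro f hf
  obtain ⟨g, hg, -⟩ := hP.univ _ (tensorQuotPairing sb hS hgS hZ hgZ hZS)
  set p := hP.pairing.liftQuot sb hS hgS hZ hgZ hZS with hp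
  set mk := tensorQuotMk sb hS hgS hZ hgZ hZS with hmk
  have hpg (y) : p.toFun (g.toFun y) = y := by
    obtain ⟨u, -, hu⟩ := hP.univ _ hP.pairing
    refine (hu (p.comp g) (fun n x hx => ?_) y).trans (hu (DGHom.id P) (fun _ _ _ => rfl) y).symm
    have := hg n x hx
    change p.toFun (g.toFun _) = _
    rw [this, tensorQuotPairing_pair sb hS hgS hZ hgZ hZS n ⟨x, hx⟩,
      TensorPairing.liftQuot_mk, TensorPairing.lift_pair]
    rfl
  have hlift (k) : ∃ t : tensorSub κ S, t.1 ∈ sb.tensorGrading E (sb.deg k + -i) ∧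
      mk t = g.toFun (f.toFun (e k)) := g.map_mem (f.map_mem (sb.homog k))
  choose t ht htg using hlift
  let F := SemifreeBasisOn.TensorHom.ofBasis sb he.r (fun k => (t k).1) ht
  have hFS (n) : F.lin n ∈ tensorSub κ S :=
    SemifreeBasisOn.TensorHom.ofBasis_mem sb he.r hS.mul_right ht (fun k => (t k).2) n
  let F' : N.carrier →ₗ[R] tensorSub κ S := F.lin.codRestrict _ hFS
  have hF : mk ∘ₗ F' = g.lin ∘ₗ f.lin := by
    refine sb.eq_of_eq_on_basis (DGModule.act _).flip (fun n b => ?_) (fun n b => ?_) fun k => ?_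
    · have : F' (N.smul n b) = hS.act κ b (F' n) := Subtype.ext (F.map_act n b)
      rw [LinearMap.comp_apply, this]
      rfl
    · exact (congrArg g.toFun (f.map_smul n b)).trans (g.map_smul _ b)
    · have : F' (e k) = t k :=
        Subtype.ext (SemifreeBasisOn.TensorHom.ofBasis_basis sb he.r _ ht k)
      rw [LinearMap.comp_apply, this, htg]
      rfl
  have hF' (n) : mk (F' n) = g.toFun (f.toFun n) := LinearMap.congr_fun hF n
  obtain ⟨h, hh, hFh⟩ := hrel F hFS fun n => by
    refine (tensorQuotMk_eq_zero sb hS hgS hZ hgZ hZS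
      (t := hS.D sb (F' n) - ksign i • F' (N.d n))).1 ?_
    rw [tensorQuotMk_sub, tensorQuotMk_zsmul, tensorQuotMk_D, ← hmk, hF', hF', ← g.comm_d, hf n,
      sub_eq_zero]
    exact map_zsmul g.lin _ _
  let H' : N.carrier →ₗ[R] tensorSub κ S := h.lin.codRestrict _ hh
  have hact (n b) : H' (N.smul n b) = hS.act κ b (H' n) := Subtype.ext (h.map_act n b)
  refine ⟨{
    toFun := fun n => hP.pairing.lift sb (H' n)
    map_add := fun m n => by rw [map_add, map_add]
    map_rsmul := fun c n => by rw [map_smul, map_smul]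
    map_smul := fun n b => by rw [hact, TensorPairing.lift_act]
    map_mem := fun {j n} hn => hP.pairing.lift_mem sb (t := H' n) (h.map_mem hn) }, fun n => ?_⟩
  have h0 : mk (F' n - (hS.D sb (H' n) + ksign i • H' (N.d n))) = 0 :=
    (tensorQuotMk_eq_zero sb hS hgS hZ hgZ hZS).2 (hFh n)
  rw [hmk, tensorQuotMk_sub, ← hmk, sub_eq_zero] at h0
  rw [← hpg (f.toFun n), ← hF', h0, hmk, hp, TensorPairing.liftQuot_mk, map_add,
    TensorPairing.lift_D, TensorPairing.lift_zsmul]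

end Quotient

end

noncomputable section

variable {R : Type} [CommRing R]

theorem SemifreeBasisOn.lt_of_coords_d_ne_zero {A : DGAlgebra R} {N : DGModule R A} {κ : Type}
    {e : κ → N.carrier} (sb : SemifreeBasisOn N e) {j k : κ} (h : sb.coords (N.d (e j)) k ≠ 0) :
    sb.lt k j := by
  obtain ⟨c, hc, hd⟩ := sb.d_lower j
  rw [hd, ← sb.equiv_apply, sb.coords_equiv] at h
  exact hc k (Finsupp.mem_support_iff.2 h)

theorem extVanish_of_one_eq_zero {B : DGAlgebra R} (h : (1 : B.carrier) = 0) (i : ℤ)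
    (N M : DGModule R B) : ExtVanish i N M := by
  have hM (x y : M.carrier) : x = y := by
    have (x : M.carrier) : x = 0 := by
      rw [← M.smul_one x, h]
      exact map_zero (M.act x)
    rw [this x, this y]
  exact fun _ _ => ⟨⟨0, fun _ _ => hM _ _, fun _ _ => hM _ _, fun _ _ => hM _ _,
    fun _ => zero_mem _⟩, fun _ => hM _ _⟩

namespace SubquotModSpec

variable {A B E : DGAlgebra R} {φ : DGAlgHom A B} {he : EnvelopingAlg φ E}
  {S Z : Submodule R E.carrier} {Q : DGModule R B}
  (spec : SubquotModSpec he (S : Set E.carrier) Z Q)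

/-- The quotient map as a linear map on the submodule. -/
def lin : S →ₗ[R] Q.carrier where
  toFun x := spec.q x
  map_add' x y := spec.q_add x y x.2 y.2
  map_smul' c x := spec.q_rsmul c x x.2

@[simp] theorem lin_apply (x : S) : spec.lin x = spec.q x := rfl

theorem q_sub {x y : E.carrier} (hx : x ∈ S) (hy : y ∈ S) :
    spec.q (x - y) = spec.q x - spec.q y :=
  map_sub spec.lin ⟨x, hx⟩ ⟨y, hy⟩

theorem q_zsmul (z : ℤ) {x : E.carrier} (hx : x ∈ S) : spec.q (z • x) = z • spec.q x :=
  map_zsmul spec.lin z ⟨x, hx⟩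

theorem q_comp (hgS : IsGradedSub E.grading S) (i : ℤ) {x : E.carrier} (hx : x ∈ S) :
    spec.q (E.comp i x) = Q.comp i (spec.q x) := by
  have hz : spec.q 0 = 0 := map_zero spec.lin
  refine hgS.induction (p := fun x => spec.q (E.comp i x) = Q.comp i (spec.q x)) hx
    (fun j x hx hj => ?_) fun x hx y hy h h' => ?_
  · rcases eq_or_ne j i with rfl | h
    · rw [homComp_of_mem _ _ hj, homComp_of_mem _ _ (spec.q_mem x hx hj)]
    · rw [homComp_of_ne _ _ h hj, homComp_of_ne _ _ h (spec.q_mem x hx hj), hz]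
  · rw [map_add, spec.q_add _ _ (hgS.homComp_mem_of_mem _ _ i hx)
      (hgS.homComp_mem_of_mem _ _ i hy), h, h', spec.q_add x y hx hy, map_add]

variable {ι : Type} {f : ι → Q.carrier} (sq : SemifreeBasisOn Q f)

theorem coords_mul_left (hS : IsStable he.l he.r S) (hgS : IsGradedSub E.grading S)
    (hcomm : ∀ b, ∀ x ∈ S, (he.l.toFun b - he.r.toFun b) * x ∈ Z) {j : ℤ} {b : B.carrier}
    (hb : b ∈ B.grading j) {x : E.carrier} (hx : x ∈ S) (k : ι) :
    sq.coords (spec.q (he.l.toFun b * x)) k =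
      ksign (sq.deg k * j) • (b * sq.coords (spec.q x) k) := by
  refine hgS.induction (p := fun x => sq.coords (spec.q (he.l.toFun b * x)) k =
    ksign (sq.deg k * j) • (b * sq.coords (spec.q x) k)) hx (fun i x hx hi => ?_)
    fun x hx y hy h h' => ?_
  · have hr : he.r.toFun b * x = ksign (j * i) • (x * he.r.toFun b) :=
      E.gcomm _ _ (he.r.map_mem hb) hi
    have hrS : he.r.toFun b * x ∈ S := hr ▸ zsmul_mem (hS.mul_right b x hx) _
    have hq : spec.q (he.l.toFun b * x) = spec.q (he.r.toFun b * x) := by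
      rw [← sub_eq_zero, ← spec.q_sub (hS.mul_left b x hx) hrS, ← sub_mul]
      refine (spec.q_ker _ ?_).2 (hcomm b x hx)
      rw [sub_mul]
      exact sub_mem (hS.mul_left b x hx) hrS
    rw [hq, hr, spec.q_zsmul _ (hS.mul_right b x hx), spec.q_act x b hx, map_zsmul,
      Finsupp.smul_apply, sq.coords_smul, B.gcomm _ b (sq.coords_mem (spec.q_mem x hx hi) k) hb,
      smul_smul, ← ksign_add]
    congr 1
    exact ksign_congr ⟨j * i - sq.deg k * j, by ring⟩
  · rw [mul_add, spec.q_add _ _ (hS.mul_left b x hx) (hS.mul_left b y hy),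
      spec.q_add x y hx hy, map_add, map_add, Finsupp.add_apply, Finsupp.add_apply, h, h', mul_add,
      smul_add]

/-- The elements of `S` all of whose coordinates modulo `Z` outside `D` vanish. -/
def coordSub (D : Finset ι) : Submodule R E.carrier where
  carrier := {x | x ∈ S ∧ ∀ k ∉ D, sq.coords (spec.q x) k = 0}
  add_mem' {x y} hx hy := ⟨add_mem hx.1 hy.1, fun k hk => by
    rw [spec.q_add x y hx.1 hy.1, map_add, Finsupp.add_apply, hx.2 k hk, hy.2 k hk, add_zero]⟩
  zero_mem' := ⟨zero_mem S, fun k _ => by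
    have hz : spec.q 0 = 0 := map_zero spec.lin
    simp [hz]⟩
  smul_mem' c x hx := ⟨S.smul_mem c hx.1, fun k hk => by
    rw [spec.q_rsmul c x hx.1, map_smul, Finsupp.smul_apply, hx.2 k hk, smul_zero]⟩

theorem coordSub_le (D : Finset ι) : spec.coordSub sq D ≤ S := fun _ h => h.1

theorem coordSub_mono {D D' : Finset ι} (h : D ⊆ D') : spec.coordSub sq D ≤ spec.coordSub sq D' :=
  fun _ hx => ⟨hx.1, fun k hk => hx.2 k fun hD => hk (h hD)⟩

theorem coordSub_univ [Fintype ι] : spec.coordSub sq Finset.univ = S :=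
  le_antisymm (spec.coordSub_le sq _) fun _ hx => ⟨hx, fun k hk => absurd (Finset.mem_univ k) hk⟩

theorem coordSub_empty (hZS : Z ≤ S) : spec.coordSub sq ∅ = Z := by
  ext x
  refine ⟨fun hx => (spec.q_ker x hx.1).1 (sq.coords_injective fun k => ?_), fun hx =>
    ⟨hZS hx, fun k _ => ?_⟩⟩
  · rw [hx.2 k (Finset.notMem_empty k)]
    simp
  · rw [(spec.q_ker x (hZS hx)).2 hx]
    simp

theorem coordSub_isStable (hS : IsStable he.l he.r S) (hgS : IsGradedSub E.grading S)
    (hcomm : ∀ b, ∀ x ∈ S, (he.l.toFun b - he.r.toFun b) * x ∈ Z) {D : Finset ι}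
    (hD : ∀ j ∈ D, ∀ k, sq.lt k j → k ∈ D) : IsStable he.l he.r (spec.coordSub sq D) where
  mul_left b x hx := by
    refine homogeneous_induction (p := fun b => he.l.toFun b * x ∈ spec.coordSub sq D) B.spanning b
      (fun j b hb => ⟨hS.mul_left b x hx.1, fun k hk => ?_⟩) fun b c hb hc => ?_
    · rw [spec.coords_mul_left sq hS hgS hcomm hb hx.1, hx.2 k hk, mul_zero, smul_zero]
    · rw [he.l.map_add, add_mul]
      exact add_mem hb hc
  mul_right b x hx := ⟨hS.mul_right b x hx.1, fun k hk => by
    rw [spec.q_act x b hx.1, sq.coords_smul, hx.2 k hk, zero_mul]⟩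
  d_mem x hx := ⟨hS.d_mem x hx.1, fun k hk => by
    have hz : B.d 0 = 0 := map_zero B.dLin
    rw [spec.q_d x hx.1, sq.coords_d, hx.2 k hk, hz, smul_zero, add_zero]
    refine Finset.sum_eq_zero fun j hj => ?_
    have hjD : j ∈ D := by
      by_contra h
      exact Finsupp.mem_support_iff.1 hj (hx.2 j h)
    by_contra h
    exact hk (hD j hjD k (sq.lt_of_coords_d_ne_zero (left_ne_zero_of_mul h)))⟩

/-- Removing a maximal index is a step with quotient of rank one. -/
def rankOneStep [DecidableEq ι] (hS : IsStable he.l he.r S) (hgS : IsGradedSub E.grading S)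
    (hcomm : ∀ b, ∀ x ∈ S, (he.l.toFun b - he.r.toFun b) * x ∈ Z) {D : Finset ι}
    (hD : ∀ j ∈ D, ∀ k, sq.lt k j → k ∈ D) {k : ι} (hk : k ∈ D) (hmax : ∀ j ∈ D, ¬ sq.lt k j) :
    RankOneStep he.l he.r (spec.coordSub sq D) (spec.coordSub sq (D.erase k)) (sq.deg k) where
  stable := spec.coordSub_isStable sq hS hgS hcomm hD
  c := Finsupp.lapply k ∘ₗ sq.coords ∘ₗ spec.lin ∘ₗ
    Submodule.inclusion (spec.coordSub_le sq D)
  c_left hb x := spec.coords_mul_left sq hS hgS hcomm hb x.2.1 k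
  c_right b x := by
    change sq.coords (spec.q (x.1 * he.r.toFun b)) k = sq.coords (spec.q x.1) k * b
    rw [spec.q_act x.1 b x.2.1, sq.coords_smul]
  c_d x := by
    change sq.coords (spec.q (E.d x.1)) k = ksign (sq.deg k) • B.d (sq.coords (spec.q x.1) k)
    rw [spec.q_d x.1 x.2.1, sq.coords_d, add_eq_right]
    refine Finset.sum_eq_zero fun j hj => ?_
    have hjD : j ∈ D := by
      by_contra h
      exact Finsupp.mem_support_iff.1 hj (x.2.2 j h)
    by_contra h
    exact hmax j hjD (sq.lt_of_coords_d_ne_zero (left_ne_zero_of_mul h))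
  c_mem x hx := sq.coords_mem (spec.q_mem x.1 x.2.1 hx) k
  c_eq_zero x := by
    change sq.coords (spec.q x.1) k = 0 ↔ _
    refine ⟨fun h => ⟨x.2.1, fun j hj => ?_⟩, fun h => h.2 k (Finset.notMem_erase k D)⟩
    rcases eq_or_ne j k with rfl | hjk
    · exact h
    · exact x.2.2 j fun hjD => hj (Finset.mem_erase.2 ⟨hjk, hjD⟩)
  x₀ := ⟨E.comp (sq.deg k) (spec.q_surj (f k)).choose, by
    obtain ⟨hy, hyk⟩ := (spec.q_surj (f k)).choose_spec
    refine ⟨hgS.homComp_mem_of_mem _ _ _ hy, fun j hj => ?_⟩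
    rw [spec.q_comp hgS _ hy, hyk, homComp_of_mem _ _ (sq.homog k), sq.coords_basis,
      Finsupp.single_eq_of_ne]
    exact fun h => hj (h ▸ hk)⟩
  x₀_mem := homComp_mem _ _ _ _
  c_x₀ := by
    obtain ⟨hy, hyk⟩ := (spec.q_surj (f k)).choose_spec
    change sq.coords (spec.q (E.comp (sq.deg k) (spec.q_surj (f k)).choose)) k = 1
    rw [spec.q_comp hgS _ hy, hyk, homComp_of_mem _ _ (sq.homog k), sq.coords_basis,
      Finsupp.single_eq_same]

theorem relExtVanish_coordSub {N : DGModule R B} {κ : Type} {e : κ → N.carrier}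
    (sb : SemifreeBasisOn N e) (hS : IsStable he.l he.r S) (hgS : IsGradedSub E.grading S)
    (hcomm : ∀ b, ∀ x ∈ S, (he.l.toFun b - he.r.toFun b) * x ∈ Z)
    (hinf : ∀ m : ℤ, m < 1 → ∀ x ∈ S, x ∈ E.grading m → x = 0)
    (hext : ∀ i : ℤ, 1 ≤ i → ExtVanish i N N) {i : ℤ} (hi : 0 ≤ i) (D : Finset ι)
    (hD : ∀ j ∈ D, ∀ k, sq.lt k j → k ∈ D) :
    sb.RelExtVanish he.l he.r i (spec.coordSub sq D) (spec.coordSub sq ∅) := by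
  classical
  induction D using Finset.strongInduction with
  | H D ih =>
    rcases D.eq_empty_or_nonempty with rfl | hne
    · exact SemifreeBasisOn.RelExtVanish.refl _ _
    obtain ⟨k, hk, hmax⟩ : ∃ k ∈ D, ∀ j ∈ D, ¬ sq.lt k j := by
      let _ : IsTrans D fun a b => sq.lt b a := ⟨fun _ _ _ h h' => sq.trans _ _ _ h' h⟩
      let _ : Std.Irrefl fun a b : D => sq.lt b a := ⟨fun a h => sq.wf.asymmetric a a h h⟩
      obtain ⟨k, -, hmax⟩ := (Finite.wellFounded_of_trans_of_irrefl
        fun a b : D => sq.lt b a).has_min Set.univ ⟨⟨_, hne.choose_spec⟩, trivial⟩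
      exact ⟨k, k.2, fun j hj => hmax ⟨j, hj⟩ trivial⟩
    let st := spec.rankOneStep sq hS hgS hcomm hD hk hmax
    refine (st.relExtVanish sb ?_).trans (spec.coordSub_mono sq (Finset.erase_subset k D))
      (ih _ (Finset.erase_ssubset hk) fun j hj m hm => ?_)
      (spec.coordSub_mono sq (Finset.empty_subset _))
    · rcases lt_or_ge (sq.deg k) 1 with hdeg | hdeg
      · refine extVanish_of_one_eq_zero ?_ _ _ _
        rw [← st.c_x₀, show st.x₀ = 0 from Subtype.ext (hinf _ hdeg _ st.x₀.2.1 st.x₀_mem),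
          map_zero]
      · exact hext _ (by omega)
    · rw [Finset.mem_erase] at hj ⊢
      exact ⟨fun h => hmax j hj.2 (h ▸ hm), hD j hj.2 m hm⟩

end SubquotModSpec

namespace QuasiSmoothData

variable {A B E : DGAlgebra R} {φ : DGAlgHom A B} {he : EnvelopingAlg φ E} {πB : DGAlgHom E B}
  (sd : QuasiSmoothData φ E he πB)

/-- The filtration of the diagonal ideal by submodules. -/
def filtSub (ℓ : ℕ) : Submodule R E.carrier where
  carrier := sd.filt ℓ
  add_mem' {x y} hx hy := sd.filt_add ℓ x y hx hy
  zero_mem' := sd.filt_zero ℓ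
  smul_mem' c x hx := sd.filt_rsmul ℓ c x hx

theorem isGradedSub_filtSub (ℓ : ℕ) : IsGradedSub E.grading (sd.filtSub ℓ) := sd.filt_graded ℓ

theorem isStable_filtSub (ℓ : ℕ) : IsStable he.l he.r (sd.filtSub ℓ) where
  mul_left b x hx := by
    refine (sd.isGradedSub_filtSub ℓ).induction (p := fun x => he.l.toFun b * x ∈ sd.filtSub ℓ) hx
      (fun i x hx hi => ?_) fun x _ y _ h h' => ?_
    · refine homogeneous_induction (p := fun b => he.l.toFun b * x ∈ sd.filtSub ℓ) B.spanning b
        (fun j b hb => ?_) fun b c hb hc => ?_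
      · rw [E.gcomm _ x (he.l.map_mem hb) hi]
        exact zsmul_mem (show x * _ ∈ sd.filtSub ℓ from sd.filt_act ℓ _ x hx) _
      · rw [he.l.map_add, add_mul]
        exact add_mem hb hc
    · rw [mul_add]
      exact add_mem h h'
  mul_right b x hx := sd.filt_act ℓ _ x hx
  d_mem x hx := sd.filt_d ℓ x hx

theorem filtSub_succ_le {ℓ : ℕ} (hℓ : 1 ≤ ℓ) : sd.filtSub (ℓ + 1) ≤ sd.filtSub ℓ :=
  sd.filt_desc ℓ hℓ

theorem filtSub_le_one {ℓ : ℕ} (hℓ : 1 ≤ ℓ) : sd.filtSub ℓ ≤ sd.filtSub 1 := by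
  induction ℓ, hℓ using Nat.le_induction with
  | base => exact le_rfl
  | succ ℓ hℓ ih => exact (sd.filtSub_succ_le hℓ).trans ih

theorem sub_mul_mem_filtSub {ℓ : ℕ} (hℓ : 1 ≤ ℓ) (b : B.carrier) {x : E.carrier}
    (hx : x ∈ sd.filtSub ℓ) : (he.l.toFun b - he.r.toFun b) * x ∈ sd.filtSub (ℓ + 1) := by
  refine (sd.filt_mul ℓ hℓ _ x ?_ hx).1
  have := map_sub πB.lin (he.l.toFun b) (he.r.toFun b)
  simpa only [DGAlgHom.lin_apply, sd.pil, sd.pir, sub_self] using this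

end QuasiSmoothData

namespace SmoothData

variable {A B E : DGAlgebra R} {φ : DGAlgHom A B} {he : EnvelopingAlg φ E} {πB : DGAlgHom E B}
  (sd : SmoothData φ E he πB) {N : DGModule R B} {κ : Type} {e : κ → N.carrier}
  (sb : SemifreeBasisOn N e)

theorem relExtVanish_succ (hext : ∀ i : ℤ, 1 ≤ i → ExtVanish i N N) {i : ℤ} (hi : 0 ≤ i) {ℓ : ℕ}
    (hℓ : 1 ≤ ℓ) : sb.RelExtVanish he.l he.r i (sd.filtSub ℓ) (sd.filtSub (ℓ + 1)) := by
  obtain ⟨Q, ⟨spec⟩, ι, f, _, ⟨sq⟩⟩ := sd.quot_finite ℓ hℓ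
  have := Fintype.ofFinite ι
  let spec' : SubquotModSpec he (sd.filtSub ℓ : Set E.carrier) (sd.filtSub (ℓ + 1)) Q := spec
  have h := spec'.relExtVanish_coordSub sq sb (sd.isStable_filtSub ℓ) (sd.isGradedSub_filtSub ℓ)
    (fun b x hx => sd.sub_mul_mem_filtSub hℓ b hx)
    (fun m hm x hx hx' => sd.filt_inf ℓ hℓ m (by omega) x hx hx') hext hi Finset.univ
    fun _ _ k _ => Finset.mem_univ k
  rwa [spec'.coordSub_univ, spec'.coordSub_empty _ (sd.filtSub_succ_le hℓ)] at h

theorem relExtVanish_one (hext : ∀ i : ℤ, 1 ≤ i → ExtVanish i N N) {i : ℤ} (hi : 0 ≤ i) {ℓ : ℕ}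
    (hℓ : 1 ≤ ℓ) : sb.RelExtVanish he.l he.r i (sd.filtSub 1) (sd.filtSub ℓ) := by
  induction ℓ, hℓ using Nat.le_induction with
  | base => exact SemifreeBasisOn.RelExtVanish.refl _ _
  | succ ℓ hℓ ih =>
    exact ih.trans (sd.filtSub_le_one hℓ) (sd.relExtVanish_succ sb hext hi hℓ)
      (sd.filtSub_succ_le hℓ)

end SmoothData

end

/-- Let `φ : A → B` be DG smooth with diagonal ideal `J = filt 1`
and filtration `J^[ℓ] = filt ℓ`. If `N` is a semifree DG `B`-module with
`Ext^i_B(N, N) = 0` for all `i ≥ 1`, then for all `i ≥ 0` and all `ℓ ≥ 1` both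
`Ext^i_B(N, N ⊗_B J^[ℓ]/J^[ℓ+1]) = 0` and `Ext^i_B(N, N ⊗_B J/J^[ℓ]) = 0`. -/
theorem ext_vanish_on_subquotients
    {R : Type} [CommRing R] {A B : DGAlgebra R} (φ : DGAlgHom A B)
    (E : DGAlgebra R) (he : EnvelopingAlg φ E) (πB : DGAlgHom E B)
    (sd : SmoothData φ E he πB)
    (N : DGModule R B) (hsf : IsSemifree N)
    (hext : ∀ i : ℤ, 1 ≤ i → ExtVanish i N N) :
    ∀ i : ℤ, 0 ≤ i → ∀ ℓ : ℕ, 1 ≤ ℓ →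
      (∀ P : DGModule R B,
        IsTensorSubquot φ he (sd.filt ℓ) (sd.filt (ℓ + 1)) N P → ExtVanish i N P) ∧
      (∀ P : DGModule R B,
        IsTensorSubquot φ he (sd.filt 1) (sd.filt ℓ) N P → ExtVanish i N P) := by
  obtain ⟨κ, e, ⟨sb⟩⟩ := hsf
  intro i hi ℓ hℓ
  refine ⟨fun P hP => ?_, fun P hP => ?_⟩
  · exact IsTensorSubquot.extVanish sb (sd.isStable_filtSub ℓ) (sd.isGradedSub_filtSub ℓ)
      (sd.isStable_filtSub (ℓ + 1)) (sd.isGradedSub_filtSub (ℓ + 1)) (sd.filtSub_succ_le hℓ) hP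
      (sd.relExtVanish_succ sb hext hi hℓ)
  · exact IsTensorSubquot.extVanish sb (sd.isStable_filtSub 1) (sd.isGradedSub_filtSub 1)
      (sd.isStable_filtSub ℓ) (sd.isGradedSub_filtSub ℓ) (sd.filtSub_le_one hℓ) hP
      (sd.relExtVanish_one sb hext hi hℓ)
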